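/- For β ∈ [π, 2π] let c_β = H(Λ_β) be the L² Hardy constant of the infinite planar sector Λ_β = {(r cos θ, r sin θ) : r > 0, 0 < θ < β}. Then there exists a critical angle β_cr ∈ (π, 2π) such that c_β = 1/4 for all β ∈ [π, β_cr], and the function β ↦ c_β is strictly decreasing on the interval [β_cr, 2π]. -/

import Mathlib

open MeasureTheory Real

/-- The infinite planar sector of angle `β`. -/
def sector (β : ℝ) : Set (EuclideanSpace ℝ (Fin 2)) :=
  {p | ∃ r θ : ℝ, 0 < r ∧ 0 < θ ∧ θ < β ∧ p 0 = r * Real.cos θ ∧ p 1 = r * Real.sin θ}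

/-- The `L²` Hardy constant of an open set `Ω ⊆ ℝⁿ`: the supremum of constants `c ≥ 0`
such that `∫_Ω ‖∇u‖² ≥ c ∫_Ω u²/d²` for all `u ∈ C_c^∞(Ω)`, where `d(x) = dist(x, Ωᶜ)`. -/
noncomputable def hardyConst {n : ℕ} (Ω : Set (EuclideanSpace ℝ (Fin n))) : ℝ :=
  sSup {c : ℝ | 0 ≤ c ∧ ∀ u : EuclideanSpace ℝ (Fin n) → ℝ,
    ContDiff ℝ (⊤ : ℕ∞) u → HasCompactSupport u → tsupport u ⊆ Ω →
    c * ∫ x in Ω, u x ^ 2 / Metric.infDist x Ωᶜ ^ 2 ≤ ∫ x in Ω, ‖gradient u x‖ ^ 2}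

open Set Filter Topology
open scoped ContDiff

/-- The distance from the point with polar coordinates `(1, θ)` to the complement of the sector of
angle `β`, see `infDist_logPolar`. -/
noncomputable def angDist (β θ : ℝ) : ℝ := sin (min (min θ (β - θ)) (π / 2))

/-- The Hardy inequality with constant `c` for the angular part of the sector of angle `β`. -/
def AngularHardy (β c : ℝ) : Prop :=
  ∀ ψ : ℝ → ℝ, ContDiff ℝ ∞ ψ → (∀ᶠ θ in 𝓝 0, ψ θ = 0) → (∀ᶠ θ in 𝓝 β, ψ θ = 0) →
    c * ∫ θ in 0..β, ψ θ ^ 2 / angDist β θ ^ 2 ≤ ∫ θ in 0..β, deriv ψ θ ^ 2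

lemma continuous_angDist (β : ℝ) : Continuous (angDist β) := by
  unfold angDist; fun_prop

lemma angDist_pos {β θ : ℝ} (h0 : 0 < θ) (h1 : θ < β) : 0 < angDist β θ := by
  have hπ := pi_pos
  apply sin_pos_of_pos_of_lt_pi
  · exact lt_min (lt_min h0 (by linarith)) (by linarith)
  · exact (min_le_right _ _).trans_lt (by linarith)

lemma angDist_le_one (β θ : ℝ) : angDist β θ ≤ 1 := sin_le_one _

lemma angDist_le_angDist_mul {β k θ : ℝ} (hk : 1 ≤ k) (h0 : 0 ≤ θ) (h1 : θ ≤ k * β) :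
    angDist β (θ / k) ≤ angDist (k * β) θ := by
  have hk0 : 0 < k := by linarith
  have hπ := pi_pos
  have ha : 0 ≤ θ / k := by positivity
  have hb : θ / k ≤ β := by rw [div_le_iff₀ hk0]; linarith
  have e1 : θ / k ≤ θ := div_le_self h0 hk
  have e2 : β - θ / k ≤ k * β - θ := by
    have : k * β - θ = k * (β - θ / k) := by field_simp
    rw [this]
    exact le_mul_of_one_le_left (by linarith) hk
  apply sin_le_sin_of_le_of_le_pi_div_two
  · have : 0 ≤ min (min (θ / k) (β - θ / k)) (π / 2) :=
      le_min (le_min ha (by linarith)) (by linarith)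
    linarith
  · exact min_le_right _ _
  · exact min_le_min (min_le_min e1 e2) le_rfl

lemma angDist_mul_le {β k θ : ℝ} (hk : 1 ≤ k) (h0 : 0 ≤ θ) (h1 : θ ≤ β) :
    angDist (k * β) (k * θ) ≤ k * angDist β θ := by
  have hk0 : 0 < k := by linarith
  have hπ := pi_pos
  set m := min (min θ (β - θ)) (π / 2) with hm
  set m' := min (min (k * θ) (k * β - k * θ)) (π / 2) with hm'
  have hm0 : 0 ≤ m := le_min (le_min h0 (by linarith)) (by linarith)
  have hm'0 : 0 ≤ m' :=
    le_min (le_min (by positivity) (by nlinarith)) (by linarith)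
  have hm'π : m' ≤ π / 2 := min_le_right _ _
  have hle : m' / k ≤ m := by
    rw [div_le_iff₀ hk0]
    refine (le_min (le_min ?_ ?_) ?_ : m' / k ≤ m) |> fun h => (div_le_iff₀ hk0).1 h
    · rw [div_le_iff₀ hk0]; linarith [min_le_left (min (k * θ) (k * β - k * θ)) (π / 2),
        min_le_left (k * θ) (k * β - k * θ)]
    · rw [div_le_iff₀ hk0]; linarith [min_le_left (min (k * θ) (k * β - k * θ)) (π / 2),
        min_le_right (k * θ) (k * β - k * θ)]
    · exact (div_le_self hm'0 hk).trans hm'π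
  have hconc : 1 / k * sin m' ≤ sin (m' / k) := by
    have h0 : (0 : ℝ) ∈ Icc 0 π := ⟨le_rfl, hπ.le⟩
    have h1 : m' ∈ Icc 0 π := ⟨hm'0, by linarith⟩
    have h2 : 0 ≤ 1 - 1 / k := by rw [sub_nonneg, div_le_one hk0]; exact hk
    have h3 : 0 ≤ 1 / k := by positivity
    have := strictConcaveOn_sin_Icc.concaveOn.2 h0 h1 h2 h3 (by ring)
    simp only [smul_eq_mul, sin_zero, mul_zero, zero_add] at this
    rwa [show 1 / k * m' = m' / k by ring] at this
  have hmono : sin (m' / k) ≤ sin m :=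
    sin_le_sin_of_le_of_le_pi_div_two (by have : 0 ≤ m' / k := by positivity
                                          linarith) (min_le_right _ _) hle
  show sin m' ≤ k * sin m
  calc sin m' = k * (1 / k * sin m') := by field_simp
    _ ≤ k * sin m := mul_le_mul_of_nonneg_left (hconc.trans hmono) hk0.le

lemma angDist_eq_one {β θ : ℝ} (h0 : π / 2 ≤ θ) (h1 : θ ≤ β - π / 2) : angDist β θ = 1 := by
  unfold angDist
  rw [min_eq_right (le_min h0 (by linarith)), sin_pi_div_two]

lemma angDist_eq_sin {β θ : ℝ} (hβ : π ≤ β) (h1 : θ ≤ π / 2) : angDist β θ = sin θ := by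
  unfold angDist
  rw [min_eq_left (show θ ≤ β - θ by linarith), min_eq_left h1]

lemma angDist_sub (β θ : ℝ) : angDist β (β - θ) = angDist β θ := by
  unfold angDist
  rw [sub_sub_cancel, min_comm (β - θ) θ]

lemma continuousOn_sq_div_sq {ψ w : ℝ → ℝ} {β : ℝ} (hψ : Continuous ψ) (hw : Continuous w)
    (h0 : ∀ᶠ θ in 𝓝 0, ψ θ = 0) (h1 : ∀ᶠ θ in 𝓝 β, ψ θ = 0)
    (hpos : ∀ θ, 0 < θ → θ < β → 0 < w θ) :
    ContinuousOn (fun θ => ψ θ ^ 2 / w θ ^ 2) (Icc 0 β) := by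
  have key : ∀ x : ℝ, (∀ᶠ θ in 𝓝 x, ψ θ = 0) →
      ContinuousAt (fun θ => ψ θ ^ 2 / w θ ^ 2) x := by
    intro x hx
    have : (fun θ => ψ θ ^ 2 / w θ ^ 2) =ᶠ[𝓝 x] fun _ => (0 : ℝ) := by
      filter_upwards [hx] with θ hθ
      simp [hθ]
    exact continuousAt_const.congr this.symm
  intro θ hθ
  apply ContinuousAt.continuousWithinAt
  rcases hθ.1.eq_or_lt with h | h
  · exact key _ (h ▸ h0)
  rcases hθ.2.eq_or_lt with h' | h'
  · exact key _ (h'.symm ▸ h1)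
  · have := hpos θ h h'
    exact ContinuousAt.div (by fun_prop) (by fun_prop) (by positivity)

lemma intervalIntegrable_sq_div_angDist {ψ : ℝ → ℝ} {β : ℝ} (hβ : 0 ≤ β) (hψ : Continuous ψ)
    (h0 : ∀ᶠ θ in 𝓝 0, ψ θ = 0) (h1 : ∀ᶠ θ in 𝓝 β, ψ θ = 0) :
    IntervalIntegrable (fun θ => ψ θ ^ 2 / angDist β θ ^ 2) volume 0 β := by
  apply ContinuousOn.intervalIntegrable
  rw [uIcc_of_le hβ]
  exact continuousOn_sq_div_sq hψ (continuous_angDist β) h0 h1 fun θ => angDist_pos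

lemma AngularHardy.scaled {β c k : ℝ} (h : AngularHardy β c) (hk : 0 < k)
    {ψ : ℝ → ℝ} (hψ : ContDiff ℝ ∞ ψ) (h0 : ∀ᶠ θ in 𝓝 0, ψ θ = 0)
    (h1 : ∀ᶠ θ in 𝓝 (k * β), ψ θ = 0) :
    c * ∫ θ in 0..(k * β), ψ θ ^ 2 / angDist β (θ / k) ^ 2 ≤
      k ^ 2 * ∫ θ in 0..(k * β), deriv ψ θ ^ 2 := by
  have hd : ∀ θ, deriv (fun x => ψ (k * x)) θ = k * deriv ψ (k * θ) := by
    intro θ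
    rw [deriv_comp_mul_left, smul_eq_mul]
  have t0 : Tendsto (fun x : ℝ => k * x) (𝓝 0) (𝓝 0) := by
    have : Continuous (fun x : ℝ => k * x) := by fun_prop
    simpa using this.tendsto 0
  have t1 : Tendsto (fun x : ℝ => k * x) (𝓝 β) (𝓝 (k * β)) := by
    have : Continuous (fun x : ℝ => k * x) := by fun_prop
    exact this.tendsto β
  have := h (fun x => ψ (k * x)) (hψ.comp (contDiff_const.mul contDiff_id))
    (t0.eventually h0) (t1.eventually h1)
  simp only [hd] at this
  have e1 : ∫ θ in 0..β, ψ (k * θ) ^ 2 / angDist β θ ^ 2 =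
      k⁻¹ * ∫ θ in 0..(k * β), ψ θ ^ 2 / angDist β (θ / k) ^ 2 := by
    have := intervalIntegral.integral_comp_mul_left (a := 0) (b := β)
      (fun θ => ψ θ ^ 2 / angDist β (θ / k) ^ 2) hk.ne'
    simp only [mul_zero, smul_eq_mul, mul_div_cancel_left₀ _ hk.ne'] at this
    exact this
  have e2 : ∫ θ in 0..β, (k * deriv ψ (k * θ)) ^ 2 =
      k⁻¹ * (k ^ 2 * ∫ θ in 0..(k * β), deriv ψ θ ^ 2) := by
    have := intervalIntegral.integral_comp_mul_left (a := 0) (b := β)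
      (fun θ => k ^ 2 * deriv ψ θ ^ 2) hk.ne'
    simp only [mul_zero, smul_eq_mul, ← mul_pow] at this
    rw [this]
    simp only [mul_pow, intervalIntegral.integral_const_mul]
  rw [e1, e2, mul_left_comm] at this
  exact le_of_mul_le_mul_left this (by positivity)

lemma AngularHardy.stretch {β c k : ℝ} (hβ : 0 ≤ β) (hc : 0 ≤ c) (h : AngularHardy β c)
    (hk : 1 ≤ k) : AngularHardy (k * β) (c / k ^ 2) := by
  intro ψ hψ h0 h1
  have hk0 : 0 < k := by linarith
  have hkβ : 0 ≤ k * β := by positivity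
  have H := h.scaled hk0 hψ h0 h1
  rw [div_mul_eq_mul_div, div_le_iff₀' (by positivity)]
  refine le_trans (mul_le_mul_of_nonneg_left ?_ hc) H
  have hpos : ∀ θ, 0 < θ → θ < k * β → 0 < angDist β (θ / k) := fun θ a b =>
    angDist_pos (by positivity) (by rw [div_lt_iff₀ hk0]; linarith)
  apply intervalIntegral.integral_mono_on_of_le_Ioo hkβ
  · exact intervalIntegrable_sq_div_angDist hkβ hψ.continuous h0 h1
  · apply ContinuousOn.intervalIntegrable
    rw [uIcc_of_le hkβ]
    exact continuousOn_sq_div_sq hψ.continuous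
      ((continuous_angDist β).comp (continuous_id.div_const k)) h0 h1 hpos
  · intro θ hθ
    have := hpos θ hθ.1 hθ.2
    have h2 := angDist_le_angDist_mul hk hθ.1.le hθ.2.le
    gcongr

/-- Compressing the angle gains a multiple of the mass in the region where `angDist` is one. -/
lemma AngularHardy.compress {β c k : ℝ} (hβ : π ≤ β) (hc : 0 ≤ c) (hk : 1 ≤ k)
    (h : AngularHardy (k * β) c) {ψ : ℝ → ℝ} (hψ : ContDiff ℝ ∞ ψ) (h0 : ∀ᶠ θ in 𝓝 0, ψ θ = 0)
    (h1 : ∀ᶠ θ in 𝓝 β, ψ θ = 0) :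
    c * ((∫ θ in 0..β, ψ θ ^ 2 / angDist β θ ^ 2) +
      (k ^ 2 - 1) * ∫ θ in (π / 2)..(β - π / 2), ψ θ ^ 2) ≤ ∫ θ in 0..β, deriv ψ θ ^ 2 := by
  have hk0 : 0 < k := by linarith
  have hπ := pi_pos
  have hβ0 : 0 ≤ β := by linarith
  have H := h.scaled (k := k⁻¹) (by positivity) (ψ := ψ) hψ h0
    (by rwa [inv_mul_cancel_left₀ hk0.ne'])
  rw [inv_mul_cancel_left₀ hk0.ne'] at H
  have H2 := mul_le_mul_of_nonneg_left H (sq_nonneg k)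
  rw [← mul_assoc (k ^ 2) (k⁻¹ ^ 2), ← mul_pow, mul_inv_cancel₀ hk0.ne', one_pow, one_mul,
    mul_left_comm, ← intervalIntegral.integral_const_mul] at H2
  refine le_trans (mul_le_mul_of_nonneg_left ?_ hc) H2
  simp only [div_inv_eq_mul, mul_comm _ k]
  have hpos : ∀ θ, 0 < θ → θ < β → 0 < angDist (k * β) (k * θ) := fun θ a b =>
    angDist_pos (by positivity) (by gcongr)
  have i1 := intervalIntegrable_sq_div_angDist hβ0 hψ.continuous h0 h1
  have i2 : IntervalIntegrable (fun θ => k ^ 2 * (ψ θ ^ 2 / angDist (k * β) (k * θ) ^ 2))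
      volume 0 β := by
    apply IntervalIntegrable.const_mul
    apply ContinuousOn.intervalIntegrable
    rw [uIcc_of_le hβ0]
    exact continuousOn_sq_div_sq hψ.continuous
      ((continuous_angDist _).comp (continuous_const.mul continuous_id)) h0 h1 hpos
  have hψc := hψ.continuous
  have basic : ∀ θ, 0 < θ → θ < β →
      ψ θ ^ 2 / angDist β θ ^ 2 ≤ k ^ 2 * (ψ θ ^ 2 / angDist (k * β) (k * θ) ^ 2) := by
    intro θ a b
    have p1 := hpos θ a b
    have p2 := angDist_mul_le hk a.le b.le
    have p3 := angDist_pos a b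
    rw [← mul_div_assoc, div_le_div_iff₀ (by positivity) (by positivity)]
    calc ψ θ ^ 2 * angDist (k * β) (k * θ) ^ 2 ≤ ψ θ ^ 2 * (k * angDist β θ) ^ 2 := by gcongr
      _ = _ := by ring
  have sub : ∀ {a b : ℝ} {f : ℝ → ℝ}, 0 ≤ a → a ≤ b → b ≤ β → IntervalIntegrable f volume 0 β →
      IntervalIntegrable f volume a b := by
    intro a b f ha hab hb hf
    apply hf.mono_set
    rw [uIcc_of_le hab, uIcc_of_le hβ0]
    exact Icc_subset_Icc ha hb
  have q1 : 0 ≤ π / 2 := by linarith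
  have q2 : π / 2 ≤ β - π / 2 := by linarith
  have q3 : β - π / 2 ≤ β := by linarith
  rw [← intervalIntegral.integral_add_adjacent_intervals
      (sub le_rfl q1 (by linarith) i1) (sub q1 (q2.trans q3) le_rfl i1),
    ← intervalIntegral.integral_add_adjacent_intervals
      (sub q1 q2 q3 i1) (sub (by linarith) q3 le_rfl i1),
    ← intervalIntegral.integral_add_adjacent_intervals
      (sub le_rfl q1 (by linarith) i2) (sub q1 (q2.trans q3) le_rfl i2),
    ← intervalIntegral.integral_add_adjacent_intervals
      (sub q1 q2 q3 i2) (sub (by linarith) q3 le_rfl i2)]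
  have s1 := intervalIntegral.integral_mono_on_of_le_Ioo q1 (sub le_rfl q1 (by linarith) i1)
    (sub le_rfl q1 (by linarith) i2) fun θ hθ => basic θ hθ.1 (by linarith [hθ.2])
  have s3 := intervalIntegral.integral_mono_on_of_le_Ioo q3 (sub (by linarith) q3 le_rfl i1)
    (sub (by linarith) q3 le_rfl i2) fun θ hθ => basic θ (by linarith [hθ.1]) hθ.2
  have s2 : (∫ θ in (π / 2)..(β - π / 2), ψ θ ^ 2 / angDist β θ ^ 2) +
      (k ^ 2 - 1) * (∫ θ in (π / 2)..(β - π / 2), ψ θ ^ 2) ≤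
      ∫ θ in (π / 2)..(β - π / 2), k ^ 2 * (ψ θ ^ 2 / angDist (k * β) (k * θ) ^ 2) := by
    rw [← intervalIntegral.integral_const_mul, ← intervalIntegral.integral_add
      (sub q1 q2 q3 i1) (by apply Continuous.intervalIntegrable; fun_prop)]
    apply intervalIntegral.integral_mono_on_of_le_Ioo q2
    · exact (sub q1 q2 q3 i1).add (by apply Continuous.intervalIntegrable; fun_prop)
    · exact sub q1 q2 q3 i2
    · intro θ hθ
      rw [angDist_eq_one hθ.1.le hθ.2.le]
      have p1 := hpos θ (by linarith [hθ.1]) (by linarith [hθ.2])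
      have p2 : angDist (k * β) (k * θ) ^ 2 ≤ 1 := pow_le_one₀ p1.le (angDist_le_one _ _)
      have p3 : ψ θ ^ 2 ≤ ψ θ ^ 2 / angDist (k * β) (k * θ) ^ 2 :=
        le_div_self (sq_nonneg _) (by positivity) p2
      have := mul_le_mul_of_nonneg_left p3 (sq_nonneg k)
      linarith
  linarith

lemma riccati_inequality {a b : ℝ} (hab : a ≤ b) {h w w' V : ℝ → ℝ} (hh : ContDiff ℝ 1 h)
    (hw : ∀ x ∈ Icc a b, HasDerivAt w (w' x) x) (hw' : ContinuousOn w' (Icc a b))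
    (hVc : ContinuousOn V (Icc a b)) (hV : ∀ x ∈ Icc a b, V x ≤ -w' x - w x ^ 2) :
    (∫ x in a..b, V x * h x ^ 2) + (w b * h b ^ 2 - w a * h a ^ 2) ≤
      ∫ x in a..b, deriv h x ^ 2 := by
  have hwc : ContinuousOn w (Icc a b) := fun x hx => (hw x hx).continuousAt.continuousWithinAt
  have hhc : Continuous h := hh.continuous
  have hh' : Continuous (deriv h) := hh.continuous_deriv le_rfl
  have hd : ∀ x ∈ uIcc a b, HasDerivAt (fun x => w x * h x ^ 2)
      (w' x * h x ^ 2 + w x * (2 * h x * deriv h x)) x := by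
    intro x hx
    rw [uIcc_of_le hab] at hx
    have h1 := (hh.differentiable one_ne_zero x).hasDerivAt
    exact ((hw x hx).fun_mul (h1.fun_pow 2)).congr_deriv (by simp)
  have hi : IntervalIntegrable (fun x => w' x * h x ^ 2 + w x * (2 * h x * deriv h x))
      volume a b := by
    apply ContinuousOn.intervalIntegrable
    rw [uIcc_of_le hab]
    fun_prop
  have hiV : IntervalIntegrable (fun x => V x * h x ^ 2) volume a b := by
    apply ContinuousOn.intervalIntegrable
    rw [uIcc_of_le hab]
    fun_prop
  rw [← intervalIntegral.integral_eq_sub_of_hasDerivAt hd hi,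
    ← intervalIntegral.integral_add hiV hi]
  apply intervalIntegral.integral_mono_on hab (hiV.add hi)
    (Continuous.intervalIntegrable (by fun_prop) _ _)
  intro x hx
  have := hV x hx
  nlinarith [sq_nonneg (deriv h x - w x * h x), mul_le_mul_of_nonneg_right this (sq_nonneg (h x))]

lemma hardy_left {h : ℝ → ℝ} (hh : ContDiff ℝ 1 h) (h0 : ∀ᶠ θ in 𝓝 0, h θ = 0) :
    (∫ θ in 0..(π / 2), 1 / 4 * (h θ ^ 2 / sin θ ^ 2)) + 1 / 9 * h (π / 2) ^ 2 ≤
      ∫ θ in 0..(π / 2), deriv h θ ^ 2 := by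
  have hπ := pi_gt_three
  obtain ⟨δ, hδ, hball⟩ := Metric.eventually_nhds_iff.1 h0
  set ε := min (δ / 2) 1 with hε
  have hε0 : 0 < ε := lt_min (by linarith) one_pos
  have hε1 : ε ≤ 1 := min_le_right _ _
  have hεδ : ε < δ := (min_le_left _ _).trans_lt (by linarith)
  have hz : ∀ θ ∈ Icc 0 ε, h θ = 0 := fun θ hθ => hball (by
    rw [Real.dist_eq, sub_zero, abs_of_nonneg hθ.1]; linarith [hθ.2])
  have hhc : Continuous h := hh.continuous
  have hh' : Continuous (deriv h) := hh.continuous_deriv le_rfl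
  have hsin : ∀ θ ∈ Icc ε (π / 2), 0 < sin θ := fun θ hθ =>
    sin_pos_of_pos_of_lt_pi (by linarith [hθ.1]) (by linarith [hθ.2])
  have hy : ∀ θ, 0 < 9 - cos θ := fun θ => by linarith [cos_le_one θ]
  have key := riccati_inequality (a := ε) (b := π / 2) (by linarith) (h := h)
    (w := fun θ => 1 / 2 * (cos θ / sin θ) + sin θ / (9 - cos θ))
    (w' := fun θ => 1 / 2 * ((-sin θ * sin θ - cos θ * cos θ) / sin θ ^ 2) +
      (cos θ * (9 - cos θ) - sin θ * sin θ) / (9 - cos θ) ^ 2)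
    (V := fun θ => 1 / 4 * (1 / sin θ ^ 2)) hh ?_ ?_ ?_ ?_
  · have e1 : ∫ θ in ε..(π / 2), 1 / 4 * (1 / sin θ ^ 2) * h θ ^ 2 =
        ∫ θ in 0..(π / 2), 1 / 4 * (h θ ^ 2 / sin θ ^ 2) := by
      have z : ∫ θ in 0..ε, 1 / 4 * (h θ ^ 2 / sin θ ^ 2) = 0 := by
        apply intervalIntegral.integral_zero_ae
        refine ae_of_all _ fun θ hθ => ?_
        rw [uIoc_of_le hε0.le] at hθ
        simp [hz θ ⟨hθ.1.le, hθ.2⟩]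
      have i1 : IntervalIntegrable (fun θ => 1 / 4 * (h θ ^ 2 / sin θ ^ 2)) volume 0 ε := by
        apply IntervalIntegrable.congr (f := fun _ => (0 : ℝ)) _ intervalIntegrable_const
        intro θ hθ
        rw [uIoc_of_le hε0.le] at hθ
        simp [hz θ ⟨hθ.1.le, hθ.2⟩]
      have i2 : IntervalIntegrable (fun θ => 1 / 4 * (h θ ^ 2 / sin θ ^ 2)) volume ε (π / 2) := by
        apply ContinuousOn.intervalIntegrable
        rw [uIcc_of_le (by linarith)]
        apply ContinuousOn.mul continuousOn_const
        apply ContinuousOn.div (by fun_prop) (by fun_prop)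
        intro θ hθ
        have := hsin θ hθ
        positivity
      rw [← intervalIntegral.integral_add_adjacent_intervals i1 i2, z, zero_add]
      congr 1
      ext θ
      ring
    have e2 : ∫ θ in ε..(π / 2), deriv h θ ^ 2 ≤ ∫ θ in 0..(π / 2), deriv h θ ^ 2 := by
      rw [← intervalIntegral.integral_add_adjacent_intervals (a := 0) (b := ε) (c := π / 2)
        (Continuous.intervalIntegrable (by fun_prop) _ _)
        (Continuous.intervalIntegrable (by fun_prop) _ _)]
      have : 0 ≤ ∫ θ in 0..ε, deriv h θ ^ 2 :=
        intervalIntegral.integral_nonneg hε0.le fun θ _ => sq_nonneg _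
      linarith
    rw [e1, hz ε ⟨hε0.le, le_rfl⟩] at key
    simp only [cos_pi_div_two, sin_pi_div_two] at key
    linarith
  · intro θ hθ
    have s := (hsin θ hθ).ne'
    have y := (hy θ).ne'
    refine (((hasDerivAt_cos θ).fun_div (hasDerivAt_sin θ) s).const_mul (1 / 2)).fun_add ?_
    refine ((hasDerivAt_sin θ).fun_div ((hasDerivAt_cos θ).const_sub 9) y).congr_deriv ?_
    ring
  · have s : ∀ θ ∈ Icc ε (π / 2), sin θ ^ 2 ≠ 0 := fun θ hθ => by
      have := hsin θ hθ
      positivity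
    have y : ∀ θ ∈ Icc ε (π / 2), (9 - cos θ) ^ 2 ≠ 0 := fun θ _ => by
      have := hy θ
      positivity
    exact (continuousOn_const.mul (ContinuousOn.div (by fun_prop) (by fun_prop) s)).add
      (ContinuousOn.div (by fun_prop) (by fun_prop) y)
  · have s : ∀ θ ∈ Icc ε (π / 2), sin θ ^ 2 ≠ 0 := fun θ hθ => by
      have := hsin θ hθ
      positivity
    exact continuousOn_const.mul (ContinuousOn.div (by fun_prop) (by fun_prop) s)
  · intro θ hθ
    have s := hsin θ hθ
    have y := hy θ
    have sc := sin_sq_add_cos_sq θ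
    have c1 := cos_le_one θ
    have : 2 * (cos θ / (9 - cos θ)) ≤ 1 / 4 := by
      rw [← mul_div_assoc, div_le_iff₀ y]; linarith
    have e : -(1 / 2 * ((-sin θ * sin θ - cos θ * cos θ) / sin θ ^ 2) +
      (cos θ * (9 - cos θ) - sin θ * sin θ) / (9 - cos θ) ^ 2) -
      (1 / 2 * (cos θ / sin θ) + sin θ / (9 - cos θ)) ^ 2 =
      1 / 4 * (1 / sin θ ^ 2) * (sin θ ^ 2 + cos θ ^ 2)
        + 1 / 4 - 2 * (cos θ / (9 - cos θ)) := by
      field_simp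
      ring
    rw [e, sc]
    linarith

lemma hardy_split {β : ℝ} (hβ : π ≤ β) {ψ : ℝ → ℝ} (hψ : ContDiff ℝ ∞ ψ)
    (h0 : ∀ᶠ θ in 𝓝 0, ψ θ = 0) (h1 : ∀ᶠ θ in 𝓝 β, ψ θ = 0) :
    1 / 4 * (∫ θ in 0..β, ψ θ ^ 2 / angDist β θ ^ 2) + 1 / 9 * ψ (π / 2) ^ 2 +
      1 / 9 * ψ (β - π / 2) ^ 2 + (∫ θ in (π / 2)..(β - π / 2), deriv ψ θ ^ 2) ≤
      (∫ θ in 0..β, deriv ψ θ ^ 2) + 1 / 4 * ∫ θ in (π / 2)..(β - π / 2), ψ θ ^ 2 := by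
  have hπ := pi_pos
  have hβ0 : 0 ≤ β := by linarith
  have hψ1 : ContDiff ℝ 1 ψ := hψ.of_le (by exact_mod_cast le_top)
  have hψ' : Continuous (deriv ψ) := hψ1.continuous_deriv le_rfl
  have L := hardy_left hψ1 h0
  have t : Tendsto (fun x : ℝ => β - x) (𝓝 0) (𝓝 β) := by
    have : Continuous (fun x : ℝ => β - x) := by fun_prop
    simpa using this.tendsto 0
  have R := hardy_left (h := fun x => ψ (β - x)) (hψ1.comp (contDiff_const.sub contDiff_id))
    (t.eventually h1)
  simp only [deriv_comp_const_sub, neg_sq] at R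
  have r1 : ∫ θ in 0..(π / 2), 1 / 4 * (ψ (β - θ) ^ 2 / sin θ ^ 2) =
      ∫ θ in (β - π / 2)..β, 1 / 4 * (ψ θ ^ 2 / sin (β - θ) ^ 2) := by
    have := intervalIntegral.integral_comp_sub_left (a := 0) (b := π / 2)
      (fun θ => 1 / 4 * (ψ θ ^ 2 / sin (β - θ) ^ 2)) β
    simpa only [sub_sub_cancel, sub_zero] using this
  have r2 : ∫ θ in 0..(π / 2), deriv ψ (β - θ) ^ 2 = ∫ θ in (β - π / 2)..β, deriv ψ θ ^ 2 := by
    have := intervalIntegral.integral_comp_sub_left (a := 0) (b := π / 2)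
      (fun θ => deriv ψ θ ^ 2) β
    simpa only [sub_zero] using this
  rw [r1, r2] at R
  have l1 : ∫ θ in 0..(π / 2), 1 / 4 * (ψ θ ^ 2 / sin θ ^ 2) =
      1 / 4 * ∫ θ in 0..(π / 2), ψ θ ^ 2 / angDist β θ ^ 2 := by
    rw [← intervalIntegral.integral_const_mul]
    apply intervalIntegral.integral_congr
    intro θ hθ
    rw [uIcc_of_le (by linarith)] at hθ
    simp only [angDist_eq_sin hβ hθ.2]
  have l2 : ∫ θ in (β - π / 2)..β, 1 / 4 * (ψ θ ^ 2 / sin (β - θ) ^ 2) =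
      1 / 4 * ∫ θ in (β - π / 2)..β, ψ θ ^ 2 / angDist β θ ^ 2 := by
    rw [← intervalIntegral.integral_const_mul]
    apply intervalIntegral.integral_congr
    intro θ hθ
    rw [uIcc_of_le (by linarith)] at hθ
    have := angDist_eq_sin (θ := β - θ) hβ (by linarith [hθ.1])
    rw [angDist_sub] at this
    simp only [this]
  have l3 : ∫ θ in (π / 2)..(β - π / 2), ψ θ ^ 2 =
      ∫ θ in (π / 2)..(β - π / 2), ψ θ ^ 2 / angDist β θ ^ 2 := by
    apply intervalIntegral.integral_congr
    intro θ hθ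
    rw [uIcc_of_le (by linarith)] at hθ
    simp only [angDist_eq_one hθ.1 hθ.2, one_pow, div_one]
  have i1 := intervalIntegrable_sq_div_angDist hβ0 hψ.continuous h0 h1
  have sub : ∀ {a b : ℝ}, 0 ≤ a → a ≤ b → b ≤ β →
      IntervalIntegrable (fun θ => ψ θ ^ 2 / angDist β θ ^ 2) volume a b := by
    intro a b ha hab hb
    apply i1.mono_set
    rw [uIcc_of_le hab, uIcc_of_le hβ0]
    exact Icc_subset_Icc ha hb
  have s1 := intervalIntegral.integral_add_adjacent_intervals
    (sub (a := 0) (b := π / 2) le_rfl (by linarith) (by linarith))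
    (sub (a := π / 2) (b := β) (by linarith) (by linarith) le_rfl)
  have s2 := intervalIntegral.integral_add_adjacent_intervals
    (sub (a := π / 2) (b := β - π / 2) (by linarith) (by linarith) (by linarith))
    (sub (a := β - π / 2) (b := β) (by linarith) (by linarith) le_rfl)
  have c : ∀ a b : ℝ, IntervalIntegrable (fun θ => deriv ψ θ ^ 2) volume a b := fun a b =>
    Continuous.intervalIntegrable (by fun_prop) _ _
  have s3 := intervalIntegral.integral_add_adjacent_intervals (c 0 (π / 2)) (c (π / 2) β)
  have s4 := intervalIntegral.integral_add_adjacent_intervals (c (π / 2) (β - π / 2))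
    (c (β - π / 2) β)
  rw [l1] at L
  rw [l2] at R
  rw [l3, ← s1, ← s2, ← s3, ← s4]
  linarith

lemma angularHardy_quarter {β : ℝ} (hβ : π ≤ β) (hβ' : β ≤ π + 4 / 9) :
    AngularHardy β (1 / 4) := by
  intro ψ hψ h0 h1
  have hπ := pi_pos
  have hψ1 : ContDiff ℝ 1 ψ := hψ.of_le (by exact_mod_cast le_top)
  have H := hardy_split hβ hψ h0 h1
  have M := riccati_inequality (a := π / 2) (b := β - π / 2) (by linarith) (h := ψ)
    (w := fun θ => 1 / 2 * (β / 2 - θ)) (w' := fun _ => 1 / 2 * (-1)) (V := fun _ => 1 / 4) hψ1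
    ?_ continuousOn_const continuousOn_const ?_
  · rw [intervalIntegral.integral_const_mul] at M
    have q1 : 0 ≤ (1 / 9 - 1 / 4 * (β - π)) * ψ (π / 2) ^ 2 :=
      mul_nonneg (by linarith) (sq_nonneg _)
    have q2 : 0 ≤ (1 / 9 - 1 / 4 * (β - π)) * ψ (β - π / 2) ^ 2 :=
      mul_nonneg (by linarith) (sq_nonneg _)
    linarith
  · intro θ _
    exact ((hasDerivAt_id θ).const_sub _).const_mul _
  · intro θ hθ
    have a1 : 1 / 2 * (β / 2 - θ) ≤ 1 / 9 := by linarith [hθ.1]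
    have a2 : -(1 / 9) ≤ 1 / 2 * (β / 2 - θ) := by linarith [hθ.2]
    nlinarith

lemma AngularHardy.improve {β k c : ℝ} (hβ : π ≤ β) (hk : 1 < k) (hc0 : 0 < c) (hc : c < 1 / 4)
    (h : AngularHardy (k * β) c) : ∃ c' > c, AngularHardy β c' := by
  set γ := c * (k ^ 2 - 1) with hγ
  have hγ0 : 0 < γ := mul_pos hc0 (by nlinarith)
  set l := γ / (γ + 1 / 4) with hl
  have hl0 : 0 < l := by positivity
  have hl1 : l < 1 := by rw [hl, div_lt_one (by positivity)]; linarith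
  have hlγ : (1 - l) * γ = l * (1 / 4) := by
    rw [hl]; field_simp; ring
  refine ⟨(1 - l) * c + l * (1 / 4), by nlinarith, ?_⟩
  intro ψ hψ h0 h1
  have H1 := h.compress hβ hc0.le hk.le hψ h0 h1
  have H2 := hardy_split hβ hψ h0 h1
  have hm : 0 ≤ ∫ θ in (π / 2)..(β - π / 2), deriv ψ θ ^ 2 :=
    intervalIntegral.integral_nonneg (by linarith) fun θ _ => sq_nonneg _
  rw [mul_add, ← mul_assoc, ← hγ] at H1
  set A := ∫ θ in 0..β, ψ θ ^ 2 / angDist β θ ^ 2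
  set M := ∫ θ in (π / 2)..(β - π / 2), ψ θ ^ 2
  set C := ∫ θ in 0..β, deriv ψ θ ^ 2
  have H2' : 1 / 4 * A ≤ C + 1 / 4 * M := by
    have := sq_nonneg (ψ (π / 2))
    have := sq_nonneg (ψ (β - π / 2))
    linarith
  have a1 := mul_le_mul_of_nonneg_left H1 (sub_nonneg.2 hl1.le)
  have a2 := mul_le_mul_of_nonneg_left H2' hl0.le
  have a3 : (1 - l) * γ * M = l * (1 / 4) * M := by rw [hlγ]
  linarith

lemma AngularHardy.anti {β k c : ℝ} (hβ : π ≤ β) (hk : 1 ≤ k) (hc0 : 0 ≤ c)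
    (h : AngularHardy (k * β) c) : AngularHardy β c := by
  intro ψ hψ h0 h1
  refine le_trans (mul_le_mul_of_nonneg_left ?_ hc0) (h.compress hβ hc0 hk hψ h0 h1)
  have hm : 0 ≤ ∫ θ in (π / 2)..(β - π / 2), ψ θ ^ 2 :=
    intervalIntegral.integral_nonneg (by linarith) fun θ _ => sq_nonneg _
  have : 0 ≤ (k ^ 2 - 1) * ∫ θ in (π / 2)..(β - π / 2), ψ θ ^ 2 := mul_nonneg (by nlinarith) hm
  linarith

/-- The substitution `sin (π θ / β) = 1 / cosh t` identifying `ℝ` with `(0, β)`. -/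
noncomputable def angleParam (β t : ℝ) : ℝ := β / π * (2 * arctan (exp t))

lemma sin_two_mul_arctan_exp (t : ℝ) : sin (2 * arctan (exp t)) = (cosh t)⁻¹ := by
  have h : (0 : ℝ) < 1 + exp t ^ 2 := by positivity
  have e : (√(1 + exp t ^ 2)) ^ 2 = 1 + exp t ^ 2 := sq_sqrt h.le
  rw [sin_two_mul, sin_arctan, cos_arctan, cosh_eq, exp_neg]
  have := sqrt_pos.2 h
  have := exp_pos t
  field_simp
  rw [e]
  ring

lemma hasDerivAt_angleParam (β t : ℝ) : HasDerivAt (angleParam β) (β / π * (cosh t)⁻¹) t := by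
  have := (((hasDerivAt_exp t).arctan).const_mul 2).const_mul (β / π)
  refine this.congr_deriv ?_
  rw [cosh_eq, exp_neg]
  have := exp_pos t
  field_simp
  ring

lemma strictMono_angleParam {β : ℝ} (hβ : 0 < β) : StrictMono (angleParam β) := by
  intro a b hab
  have : arctan (exp a) < arctan (exp b) := arctan_strictMono (exp_lt_exp.2 hab)
  have := pi_pos
  unfold angleParam
  gcongr

lemma angleParam_mem {β : ℝ} (hβ : 0 < β) (t : ℝ) : angleParam β t ∈ Ioo 0 β := by
  have h1 : 0 < arctan (exp t) := arctan_pos.2 (exp_pos t)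
  have h2 := arctan_lt_pi_div_two (exp t)
  have hπ := pi_pos
  refine ⟨by unfold angleParam; positivity, ?_⟩
  calc angleParam β t < β / π * π := by unfold angleParam; gcongr; linarith
    _ = β := by field_simp

lemma log_tan_angleParam {β : ℝ} (hβ : 0 < β) (t : ℝ) :
    log (tan (π / (2 * β) * angleParam β t)) = t := by
  have hπ := pi_pos
  have : π / (2 * β) * angleParam β t = arctan (exp t) := by
    unfold angleParam; field_simp
  rw [this, tan_arctan, log_exp]

lemma angleParam_log_tan {β θ : ℝ} (h : θ ∈ Ioo 0 β) :
    angleParam β (log (tan (π / (2 * β) * θ))) = θ := by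
  have hπ := pi_pos
  have hβ : 0 < β := h.1.trans h.2
  have h0 : 0 < π / (2 * β) * θ := by have := h.1; positivity
  have h1 : π / (2 * β) * θ < π / 2 := by
    calc π / (2 * β) * θ < π / (2 * β) * β := by have := h.2; gcongr
      _ = π / 2 := by field_simp
  unfold angleParam
  rw [exp_log (tan_pos_of_pos_of_lt_pi_div_two h0 h1), arctan_tan (by linarith) h1]
  field_simp

lemma AngularHardy.substitute {β c R₀ R : ℝ} (hβ : 0 < β) (h : AngularHardy β c)
    (hR : R₀ < R) {χ : ℝ → ℝ} (hχ : ContDiff ℝ ∞ χ) (hsupp : ∀ t, R₀ ≤ |t| → χ t = 0) :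
    c * ∫ t in (-R)..R, χ t ^ 2 / angDist β (angleParam β t) ^ 2 * (β / π * (cosh t)⁻¹) ≤
      ∫ t in (-R)..R, deriv χ t ^ 2 * (π / β * cosh t) := by
  classical
  have hπ := pi_pos
  set p := angleParam β with hp
  have hpm := strictMono_angleParam hβ
  have hmem := angleParam_mem hβ
  set ψ : ℝ → ℝ := fun θ => if θ ∈ Ioo 0 β then χ (log (tan (π / (2 * β) * θ))) else 0 with hψ
  have ψp : ∀ t, ψ (p t) = χ t := fun t => by
    simp only [hψ, if_pos (hmem t), hp, log_tan_angleParam hβ]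
  have ψ0 : ∀ θ, θ ≤ p (-R₀) → ψ θ = 0 := by
    intro θ hθ
    by_cases hm : θ ∈ Ioo 0 β
    · have e : p (log (tan (π / (2 * β) * θ))) = θ := angleParam_log_tan hm
      rw [← e] at hθ ⊢
      rw [ψp]
      apply hsupp
      have := hpm.le_iff_le.1 hθ
      rw [le_abs]; right; linarith
    · simp only [hψ, if_neg hm]
  have ψ1 : ∀ θ, p R₀ ≤ θ → ψ θ = 0 := by
    intro θ hθ
    by_cases hm : θ ∈ Ioo 0 β
    · have e : p (log (tan (π / (2 * β) * θ))) = θ := angleParam_log_tan hm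
      rw [← e] at hθ ⊢
      rw [ψp]
      apply hsupp
      have := hpm.le_iff_le.1 hθ
      rw [le_abs]; left; linarith
    · simp only [hψ, if_neg hm]
  have ev0 : ∀ x < p (-R₀), ∀ᶠ θ in 𝓝 x, ψ θ = 0 := fun x hx => by
    filter_upwards [Iio_mem_nhds hx] with θ hθ using ψ0 θ (le_of_lt hθ)
  have ev1 : ∀ x, p R₀ < x → ∀ᶠ θ in 𝓝 x, ψ θ = 0 := fun x hx => by
    filter_upwards [Ioi_mem_nhds hx] with θ hθ using ψ1 θ (le_of_lt hθ)
  have hψs : ContDiff ℝ ∞ ψ := by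
    rw [contDiff_iff_contDiffAt]
    intro θ
    have zero : (∀ᶠ x in 𝓝 θ, ψ x = 0) → ContDiffAt ℝ ∞ ψ θ := fun hz =>
      (contDiffAt_const (c := (0 : ℝ))).congr_of_eventuallyEq hz
    rcases le_or_gt θ 0 with h0 | h0
    · exact zero (ev0 θ (h0.trans_lt (hmem _).1))
    rcases le_or_gt β θ with h1 | h1
    · exact zero (ev1 θ ((hmem _).2.trans_le h1))
    have a0 : 0 < π / (2 * β) * θ := by positivity
    have a1 : π / (2 * β) * θ < π / 2 := by
      calc π / (2 * β) * θ < π / (2 * β) * β := by gcongr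
        _ = π / 2 := by field_simp
    have hcos : cos (π / (2 * β) * θ) ≠ 0 := (cos_pos_of_mem_Ioo ⟨by linarith, a1⟩).ne'
    have htan : tan (π / (2 * β) * θ) ≠ 0 := (tan_pos_of_pos_of_lt_pi_div_two a0 a1).ne'
    have : ContDiffAt ℝ ∞ (fun θ => χ (log (tan (π / (2 * β) * θ)))) θ := by
      refine ContDiffAt.comp θ hχ.contDiffAt (ContDiffAt.log ?_ htan)
      exact ContDiffAt.comp (g := tan) (f := fun x => π / (2 * β) * x) θ
        (contDiffAt_tan.2 hcos) (by fun_prop)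
    apply this.congr_of_eventuallyEq
    filter_upwards [Ioo_mem_nhds h0 h1] with x hx
    simp only [hψ, if_pos hx]
  have z0 := ev0 0 (hmem _).1
  have z1 := ev1 β (hmem _).2
  have H := h ψ hψs z0 z1
  have hdψ : ∀ t, deriv ψ (p t) * (β / π * (cosh t)⁻¹) = deriv χ t := by
    intro t
    have d1 := ((hψs.differentiable (by simp)) (p t)).hasDerivAt
    have d2 := d1.comp t (hasDerivAt_angleParam β t)
    have : ψ ∘ angleParam β = χ := funext ψp
    rw [this] at d2
    exact d2.deriv.symm
  have dψ0 : ∀ θ, θ ∉ Ioc (p (-R)) (p R) → deriv ψ θ = 0 := by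
    intro θ hθ
    have : ∀ᶠ x in 𝓝 θ, ψ x = 0 := by
      rw [mem_Ioc, not_and_or, not_lt, not_le] at hθ
      rcases hθ with h | h
      · exact ev0 θ (h.trans_lt (hpm (by linarith)))
      · exact ev1 θ ((hpm hR).trans h)
    have : ψ =ᶠ[𝓝 θ] fun _ => 0 := this
    rw [this.deriv_eq, deriv_const]
  have ψ01 : ∀ θ, θ ∉ Ioc (p (-R)) (p R) → ψ θ = 0 := by
    intro θ hθ
    rw [mem_Ioc, not_and_or, not_lt, not_le] at hθ
    rcases hθ with h | h
    · exact ψ0 θ (h.trans (hpm.monotone (by linarith)))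
    · exact ψ1 θ ((hpm hR).trans h).le
  have restrict : ∀ f : ℝ → ℝ, (∀ θ, θ ∉ Ioc (p (-R)) (p R) → f θ = 0) →
      ∫ θ in 0..β, f θ = ∫ θ in (p (-R))..(p R), f θ := by
    intro f hf
    have s : Function.support f ⊆ Ioc (p (-R)) (p R) := fun θ hθ => by
      by_contra hn
      exact hθ (hf θ hn)
    rw [intervalIntegral.integral_eq_integral_of_support_subset s,
      intervalIntegral.integral_eq_integral_of_support_subset]
    exact s.trans (Ioc_subset_Ioc (hmem _).1.le (hmem _).2.le)
  rw [restrict _ (fun θ hθ => by simp [ψ01 θ hθ]), restrict _ (fun θ hθ => by simp [dψ0 θ hθ])] at H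
  have hpc : ContinuousOn (fun t => β / π * (cosh t)⁻¹) (uIcc (-R) R) := by
    apply Continuous.continuousOn
    exact continuous_const.mul (continuous_cosh.inv₀ fun t => (cosh_pos t).ne')
  have c1 := intervalIntegral.integral_comp_mul_deriv' (a := -R) (b := R)
    (f := p) (f' := fun t => β / π * (cosh t)⁻¹) (g := fun θ => ψ θ ^ 2 / angDist β θ ^ 2)
    (fun t _ => hasDerivAt_angleParam β t) hpc
    ((continuousOn_sq_div_sq hψs.continuous (continuous_angDist β) z0 z1
      (fun θ => angDist_pos)).mono (by
        rintro _ ⟨t, _, rfl⟩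
        exact ⟨(hmem t).1.le, (hmem t).2.le⟩))
  have c2 := intervalIntegral.integral_comp_mul_deriv (a := -R) (b := R)
    (f := p) (f' := fun t => β / π * (cosh t)⁻¹) (g := fun θ => deriv ψ θ ^ 2)
    (fun t _ => hasDerivAt_angleParam β t) hpc
    ((hψs.continuous_deriv (by simp)).pow 2)
  simp only [Function.comp_apply, ψp] at c1 c2
  rw [← c1, ← c2] at H
  refine H.trans_eq ?_
  congr 1
  ext t
  rw [← hdψ]
  have := cosh_pos t
  field_simp

/-- The angular Hardy inequality in logarithmic coordinates, after removing the ground state. -/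
lemma AngularHardy.log_form {β c R₀ R : ℝ} (hβ : 0 < β) (h : AngularHardy β c) (hR₀ : 0 < R₀)
    (hR : R₀ < R) {η : ℝ → ℝ} (hη : ContDiff ℝ ∞ η) (hsupp : ∀ t, R₀ ≤ |t| → η t = 0) :
    c * ∫ t in (-R)..R, η t ^ 2 * (β / π / (cosh t * angDist β (angleParam β t))) ^ 2 ≤
      (∫ t in (-R)..R, deriv η t ^ 2) +
        1 / 4 * ∫ t in (-R)..R, η t ^ 2 * (1 + ((cosh t)⁻¹) ^ 2) := by
  have hπ := pi_pos
  have hch := cosh_pos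
  have hη' : Continuous (deriv η) := hη.continuous_deriv (by simp)
  have hηc := hη.continuous
  have hci : Continuous fun t => (cosh t)⁻¹ := continuous_cosh.inv₀ fun t => (cosh_pos t).ne'
  have hsq : ∀ t, √(cosh t) ^ 2 = cosh t := fun t => sq_sqrt (hch t).le
  have hsp : ∀ t, 0 < √(cosh t) := fun t => sqrt_pos.2 (hch t)
  have hdη : ∀ t, HasDerivAt η (deriv η t) t := fun t =>
    (hη.differentiable (by simp) t).hasDerivAt
  have H := h.substitute hβ hR (χ := fun t => η t / √(cosh t))
    (hη.div (contDiff_cosh.sqrt fun t => (hch t).ne') fun t => (hsp t).ne')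
    (fun t ht => by simp [hsupp t ht])
  have hd : ∀ t, deriv (fun t => η t / √(cosh t)) t =
      (deriv η t - 1 / 2 * (sinh t * (cosh t)⁻¹) * η t) / √(cosh t) := by
    intro t
    have := ((hdη t).fun_div ((hasDerivAt_cosh t).sqrt (hch t).ne') (hsp t).ne').deriv
    rw [this]
    have h1 := hch t
    have h2 := hsp t
    field_simp
    rw [hsq]
    field_simp
  have e1 : ∀ t, (η t / √(cosh t)) ^ 2 / angDist β (angleParam β t) ^ 2 * (β / π * (cosh t)⁻¹) =
      π / β * (η t ^ 2 * (β / π / (cosh t * angDist β (angleParam β t))) ^ 2) := by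
    intro t
    have h1 := hch t
    have h2 := angDist_pos (angleParam_mem hβ t).1 (angleParam_mem hβ t).2
    rw [div_pow, hsq]
    field_simp
  have e2 : ∀ t, deriv (fun t => η t / √(cosh t)) t ^ 2 * (π / β * cosh t) =
      π / β * (deriv η t - 1 / 2 * (sinh t * (cosh t)⁻¹) * η t) ^ 2 := by
    intro t
    have h1 := hch t
    rw [hd, div_pow, hsq]
    field_simp
  simp only [e1, e2, intervalIntegral.integral_const_mul] at H
  rw [mul_left_comm] at H
  refine (le_of_mul_le_mul_left H (by positivity)).trans_eq ?_
  have ftc : ∫ t in (-R)..R, (1 / 2 * ((cosh t)⁻¹ ^ 2 * η t ^ 2) +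
      sinh t * (cosh t)⁻¹ * (η t * deriv η t)) = 0 := by
    rw [intervalIntegral.integral_eq_sub_of_hasDerivAt
      (f := fun t => 1 / 2 * (sinh t / cosh t * η t ^ 2))]
    · rw [hsupp R (by rw [abs_of_pos] <;> linarith),
        hsupp (-R) (by rw [abs_neg, abs_of_pos] <;> linarith)]
      simp
    · intro t _
      have h1 := (hch t).ne'
      refine ((((hasDerivAt_sinh t).fun_div (hasDerivAt_cosh t) h1).fun_mul
        ((hdη t).fun_pow 2)).const_mul (1 / 2)).congr_deriv ?_
      have := cosh_sq t
      field_simp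
      simp only [Nat.cast_ofNat, Nat.add_one_sub_one, pow_one]
      rw [this]
      ring
    · apply Continuous.intervalIntegrable
      fun_prop
  have ii : ∀ f : ℝ → ℝ, Continuous f → IntervalIntegrable f volume (-R) R := fun f hf =>
    hf.intervalIntegrable _ _
  rw [← add_zero (∫ t in (-R)..R, (deriv η t - 1 / 2 * (sinh t * (cosh t)⁻¹) * η t) ^ 2), ← ftc,
    ← intervalIntegral.integral_const_mul, ← intervalIntegral.integral_add (ii _ (by fun_prop))
    (ii _ (by fun_prop)), ← intervalIntegral.integral_add (ii _ (by fun_prop))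
    (ii _ (by fun_prop))]
  congr 1
  ext t
  have := sinh_sq t
  have h1 := (hch t).ne'
  field_simp
  linear_combination (4 * η t ^ 2) * this

/-- A smooth bump equal to one on `[-1, 1]` and supported in `[-2, 2]`. -/
noncomputable def hardyBump : ContDiffBump (0 : ℝ) := ⟨1, 2, one_pos, one_lt_two⟩

lemma hardyBump_eq_zero {t : ℝ} (h : 2 ≤ |t|) : hardyBump t = 0 :=
  hardyBump.zero_of_le_dist (by simpa [hardyBump, Real.dist_eq] using h)

lemma hardyBump_eq_one {t : ℝ} (h : |t| ≤ 1) : hardyBump t = 1 :=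
  hardyBump.one_of_mem_closedBall (by simpa [hardyBump, Real.dist_eq] using h)

lemma integral_hardyBump_sq_pos : 0 < ∫ t in (-3)..(3 : ℝ), hardyBump t ^ 2 := by
  have hc : Continuous hardyBump := hardyBump.continuous
  have e : ∫ t in (-1)..(1 : ℝ), hardyBump t ^ 2 = ∫ _ in (-1)..(1 : ℝ), (1 : ℝ) := by
    apply intervalIntegral.integral_congr
    intro t ht
    rw [uIcc_of_le (by norm_num)] at ht
    simp [hardyBump_eq_one (abs_le.2 ht)]
  have le : ∫ t in (-1)..(1 : ℝ), hardyBump t ^ 2 ≤ ∫ t in (-3)..(3 : ℝ), hardyBump t ^ 2 :=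
    intervalIntegral.integral_mono_interval (by norm_num) (by norm_num) (by norm_num)
      (ae_of_all _ fun t => sq_nonneg _) (Continuous.intervalIntegrable (by fun_prop) _ _)
  rw [e, intervalIntegral.integral_const, smul_eq_mul] at le
  linarith

lemma integral_comp_div_bump {f : ℝ → ℝ} {n : ℝ} (hn : 0 < n) :
    ∫ t in (-(3 * n))..(3 * n), f (t / n) = n * ∫ t in (-3)..(3 : ℝ), f t := by
  rw [intervalIntegral.integral_comp_div f hn.ne', smul_eq_mul, neg_div,
    mul_div_cancel_right₀ _ hn.ne']

lemma AngularHardy.bump_form {β c n : ℝ} (hβ : 0 < β) (h : AngularHardy β c) (hn : 1 ≤ n) :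
    c * ∫ t in (-(3 * n))..(3 * n),
        hardyBump (t / n) ^ 2 * (β / π / (cosh t * angDist β (angleParam β t))) ^ 2 ≤
      1 / n * (∫ t in (-3)..(3 : ℝ), deriv hardyBump t ^ 2) +
        1 / 4 * ∫ t in (-(3 * n))..(3 * n), hardyBump (t / n) ^ 2 * (1 + ((cosh t)⁻¹) ^ 2) := by
  have hn0 : 0 < n := by linarith
  have H := h.log_form hβ (R₀ := 2 * n) (R := 3 * n) (by linarith) (by linarith)
    (η := fun t => hardyBump (t / n)) (hardyBump.contDiff.comp (contDiff_id.div_const n))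
    (fun t ht => hardyBump_eq_zero (by
      rw [abs_div, abs_of_pos hn0, le_div_iff₀ hn0]; exact ht))
  refine H.trans_eq ?_
  congr 1
  have : ∀ t, deriv (fun t => hardyBump (t / n)) t ^ 2 =
      1 / n ^ 2 * deriv hardyBump (t / n) ^ 2 := by
    intro t
    have := deriv_comp_mul_left n⁻¹ hardyBump t
    simp only [div_eq_inv_mul, this, smul_eq_mul]
    ring
  simp only [this, intervalIntegral.integral_const_mul]
  rw [integral_comp_div_bump (f := fun t => deriv hardyBump t ^ 2) hn0]
  field_simp

lemma continuous_inv_cosh : Continuous fun t => (cosh t)⁻¹ :=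
  continuous_cosh.inv₀ fun t => (cosh_pos t).ne'

lemma continuous_angleParam (β : ℝ) : Continuous (angleParam β) :=
  continuous_iff_continuousAt.2 fun t => (hasDerivAt_angleParam β t).continuousAt

lemma continuous_log_potential {β : ℝ} (hβ : 0 < β) :
    Continuous fun t => (β / π / (cosh t * angDist β (angleParam β t))) ^ 2 := by
  have h : ∀ t, 0 < angDist β (angleParam β t) := fun t =>
    angDist_pos (angleParam_mem hβ t).1 (angleParam_mem hβ t).2
  refine (Continuous.div continuous_const (continuous_cosh.mul
    ((continuous_angDist β).comp (continuous_angleParam β))) fun t => ?_).pow 2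
  exact (mul_pos (cosh_pos t) (h t)).ne'

lemma integral_inv_cosh_sq_le (R : ℝ) : ∫ t in (-R)..R, ((cosh t)⁻¹) ^ 2 ≤ 2 := by
  rw [intervalIntegral.integral_eq_sub_of_hasDerivAt (f := fun t => sinh t / cosh t)]
  · have h1 : sinh R / cosh R ≤ 1 := (div_le_one (cosh_pos R)).2 (sinh_lt_cosh R).le
    simp only [sinh_neg, cosh_neg, neg_div]
    linarith
  · intro t _
    have h1 := (cosh_pos t).ne'
    refine ((hasDerivAt_sinh t).fun_div (hasDerivAt_cosh t) h1).congr_deriv ?_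
    have := cosh_sq t
    field_simp
    rw [this]
    ring
  · apply Continuous.intervalIntegrable
    exact continuous_inv_cosh.pow 2

lemma AngularHardy.le_quarter {β c : ℝ} (hβ : π ≤ β) (hc : 0 ≤ c) (h : AngularHardy β c) :
    c ≤ 1 / 4 := by
  have hπ := pi_pos
  have hβ0 : 0 < β := by linarith
  have hk : 1 ≤ β / π := (one_le_div hπ).2 hβ
  have hb : Continuous hardyBump := hardyBump.continuous
  have hci := continuous_inv_cosh
  have hX := integral_hardyBump_sq_pos
  set X := ∫ t in (-3)..(3 : ℝ), hardyBump t ^ 2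
  set Y := ∫ t in (-3)..(3 : ℝ), deriv hardyBump t ^ 2 with hY
  have hY0 : 0 ≤ Y := intervalIntegral.integral_nonneg (by norm_num) fun t _ => sq_nonneg _
  have main : ∀ n : ℝ, 1 ≤ n → (c - 1 / 4) * X * n ≤ Y + 1 / 2 := by
    intro n hn
    have hn0 : 0 < n := by linarith
    have H := h.bump_form hβ0 hn
    have hX' : ∫ t in (-(3 * n))..(3 * n), hardyBump (t / n) ^ 2 = n * X :=
      integral_comp_div_bump (f := fun t => hardyBump t ^ 2) hn0
    have low : ∫ t in (-(3 * n))..(3 * n), hardyBump (t / n) ^ 2 ≤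
        ∫ t in (-(3 * n))..(3 * n),
          hardyBump (t / n) ^ 2 * (β / π / (cosh t * angDist β (angleParam β t))) ^ 2 := by
      have hw := continuous_log_potential hβ0
      apply intervalIntegral.integral_mono_on (by linarith)
        (Continuous.intervalIntegrable (by fun_prop) _ _)
        (Continuous.intervalIntegrable (by fun_prop) _ _)
      intro t _
      apply le_mul_of_one_le_right (sq_nonneg _)
      apply one_le_pow₀
      have h1 := cosh_pos t
      have h2 := angDist_pos (angleParam_mem hβ0 t).1 (angleParam_mem hβ0 t).2
      rw [one_le_div (by positivity)]
      have m := angleParam_mem (β := π) hπ t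
      have h3 := angDist_mul_le (β := π) hk m.1.le m.2.le
      have e : β / π * angleParam π t = angleParam β t := by
        unfold angleParam; field_simp
      have e' : angDist π (angleParam π t) ≤ (cosh t)⁻¹ := by
        have : angleParam π t = 2 * arctan (exp t) := by unfold angleParam; field_simp
        rw [← sin_two_mul_arctan_exp, ← this]
        rcases le_total (angleParam π t) (π / 2) with h | h
        · exact (angDist_eq_sin le_rfl h).le
        · rw [← angDist_sub, angDist_eq_sin le_rfl (by linarith), sin_pi_sub]
      rw [e, div_mul_cancel₀ _ hπ.ne'] at h3
      calc cosh t * angDist β (angleParam β t) ≤ cosh t * (β / π * (cosh t)⁻¹) := by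
            gcongr; exact h3.trans (by gcongr)
        _ = β / π := by field_simp
    have up : ∫ t in (-(3 * n))..(3 * n), hardyBump (t / n) ^ 2 * (1 + ((cosh t)⁻¹) ^ 2) ≤
        n * X + 2 := by
      rw [← hX']
      refine le_trans ?_ (add_le_add_right (integral_inv_cosh_sq_le (3 * n)) _)
      rw [← intervalIntegral.integral_add (Continuous.intervalIntegrable (by fun_prop) _ _)
        (Continuous.intervalIntegrable (by fun_prop) _ _)]
      apply intervalIntegral.integral_mono_on (by linarith)
        (Continuous.intervalIntegrable (by fun_prop) _ _)
        (Continuous.intervalIntegrable (by fun_prop) _ _)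
      intro t _
      have b1 : hardyBump (t / n) ^ 2 ≤ 1 := pow_le_one₀ hardyBump.nonneg hardyBump.le_one
      nlinarith [mul_le_mul_of_nonneg_right b1 (sq_nonneg (cosh t)⁻¹)]
    have hYn : 1 / n * Y ≤ Y := mul_le_of_le_one_left hY0 (by rw [div_le_one hn0]; exact hn)
    rw [hX'] at low
    have := mul_le_mul_of_nonneg_left low hc
    linarith
  by_contra! hlt
  have hpos : 0 < (c - 1 / 4) * X := mul_pos (by linarith) hX
  have := main ((Y + 1 / 2) / ((c - 1 / 4) * X) + 1) (by
    have : 0 ≤ (Y + 1 / 2) / ((c - 1 / 4) * X) := by positivity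
    linarith)
  rw [mul_add, mul_div_cancel₀ _ hpos.ne'] at this
  linarith

lemma log_potential_two_pi (t : ℝ) : 1 + ((cosh t)⁻¹) ^ 2 + ((cosh t)⁻¹) ^ 4 ≤
    (2 * π / π / (cosh t * angDist (2 * π) (angleParam (2 * π) t))) ^ 2 := by
  have hπ := pi_pos
  have h0 := cosh_pos t
  have m := angleParam_mem (β := 2 * π) (by linarith) t
  have hD := angDist_pos m.1 m.2
  set D := angDist (2 * π) (angleParam (2 * π) t) with hDdef
  set θ := angleParam (2 * π) t with hθ
  have e : θ = 2 * (2 * arctan (exp t)) := by rw [hθ]; unfold angleParam; field_simp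
  set s := (cosh t)⁻¹ with hs
  have hs0 : 0 < s := by positivity
  have hs1 : s ≤ 1 := inv_le_one_of_one_le₀ (one_le_cosh t)
  set a := 2 * arctan (exp t)
  have hsa : sin a = s := sin_two_mul_arctan_exp t
  have hsc := sin_sq_add_cos_sq a
  rw [hsa] at hsc
  have hsin2 : sin θ ^ 2 = 4 * s ^ 2 * (1 - s ^ 2) := by
    rw [e, sin_two_mul, hsa]
    linear_combination (4 * s ^ 2) * hsc
  have hs2 : s ^ 2 ≤ 1 := pow_le_one₀ hs0.le hs1
  have key : D ^ 2 * (1 + s ^ 2 + s ^ 4) ≤ 4 * s ^ 2 := by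
    have case1 : D ^ 2 = sin θ ^ 2 → D ^ 2 * (1 + s ^ 2 + s ^ 4) ≤ 4 * s ^ 2 := by
      intro h
      rw [h, hsin2]
      nlinarith [mul_nonneg (sq_nonneg s) (pow_nonneg hs0.le 6)]
    rcases le_total θ (π / 2) with h | h
    · exact case1 (by rw [hDdef, angDist_eq_sin (by linarith) h])
    rcases le_total (2 * π - θ) (π / 2) with h' | h'
    · apply case1
      rw [hDdef, ← angDist_sub, angDist_eq_sin (by linarith) h', sin_two_pi_sub, neg_sq]
    · rw [hDdef, angDist_eq_one h (by linarith)]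
      have c := cos_nonpos_of_pi_div_two_le_of_le (x := θ) h (by linarith)
      rw [e, cos_two_mul] at c
      nlinarith
  have : 2 * π / π / (cosh t * D) = 2 * s / D := by
    rw [hs]; field_simp
  rw [this, div_pow, le_div_iff₀ (by positivity)]
  linarith

lemma not_angularHardy_two_pi : ¬ AngularHardy (2 * π) (1 / 4) := by
  intro h
  have hπ := pi_pos
  have hβ0 : 0 < 2 * π := by linarith
  have hb : Continuous hardyBump := hardyBump.continuous
  have hci := continuous_inv_cosh
  set Y := ∫ t in (-3)..(3 : ℝ), deriv hardyBump t ^ 2 with hY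
  set δ := ∫ t in (-1)..(1 : ℝ), ((cosh t)⁻¹) ^ 4 with hδ
  have hδ0 : 0 < δ := by
    apply intervalIntegral.intervalIntegral_pos_of_pos
      (Continuous.intervalIntegrable (by fun_prop) _ _) _ (by norm_num)
    intro t
    have := cosh_pos t
    positivity
  have main : ∀ n : ℝ, 1 ≤ n → δ * n ≤ 4 * Y := by
    intro n hn
    have hn0 : 0 < n := by linarith
    have H := h.bump_form hβ0 hn
    have low : (∫ t in (-(3 * n))..(3 * n), hardyBump (t / n) ^ 2 * (1 + ((cosh t)⁻¹) ^ 2)) +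
        (∫ t in (-(3 * n))..(3 * n), hardyBump (t / n) ^ 2 * ((cosh t)⁻¹) ^ 4) ≤
        ∫ t in (-(3 * n))..(3 * n), hardyBump (t / n) ^ 2 *
          (2 * π / π / (cosh t * angDist (2 * π) (angleParam (2 * π) t))) ^ 2 := by
      have hw := continuous_log_potential hβ0
      rw [← intervalIntegral.integral_add (Continuous.intervalIntegrable (by fun_prop) _ _)
        (Continuous.intervalIntegrable (by fun_prop) _ _)]
      apply intervalIntegral.integral_mono_on (by linarith)
        (Continuous.intervalIntegrable (by fun_prop) _ _)
        (Continuous.intervalIntegrable (by fun_prop) _ _)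
      intro t _
      rw [← mul_add]
      exact mul_le_mul_of_nonneg_left (log_potential_two_pi t) (sq_nonneg _)
    have gain : δ ≤ ∫ t in (-(3 * n))..(3 * n), hardyBump (t / n) ^ 2 * ((cosh t)⁻¹) ^ 4 := by
      have e : δ = ∫ t in (-1)..(1 : ℝ), hardyBump (t / n) ^ 2 * ((cosh t)⁻¹) ^ 4 := by
        apply intervalIntegral.integral_congr
        intro t ht
        rw [uIcc_of_le (by norm_num)] at ht
        have : hardyBump (t / n) = 1 := hardyBump_eq_one (by
          rw [abs_div, abs_of_pos hn0, div_le_one hn0]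
          exact (abs_le.2 ht).trans hn)
        simp [this]
      rw [e]
      apply intervalIntegral.integral_mono_interval (by linarith) (by norm_num) (by linarith)
      · exact ae_of_all _ fun t => by have := cosh_pos t; positivity
      · exact Continuous.intervalIntegrable (by fun_prop) _ _
    have : 1 / 4 * δ ≤ 1 / n * Y := by linarith
    have := mul_le_mul_of_nonneg_right this hn0.le
    field_simp at this
    linarith
  have hY0 : 0 ≤ Y := intervalIntegral.integral_nonneg (by norm_num) fun t _ => sq_nonneg _
  have := main (4 * Y / δ + 1) (by
    have : 0 ≤ 4 * Y / δ := by positivity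
    linarith)
  rw [mul_add, mul_div_cancel₀ _ hδ0.ne'] at this
  linarith

/-- The point of the plane with logarithmic polar coordinates `(t, θ)`. -/
noncomputable def logPolar (z : ℝ × ℝ) : EuclideanSpace ℝ (Fin 2) :=
  !₂[exp z.1 * cos z.2, exp z.1 * sin z.2]

lemma contDiff_logPolar : ContDiff ℝ ∞ logPolar := by
  rw [contDiff_euclidean]
  intro i
  fin_cases i
  · simp only [logPolar]
    exact contDiff_fst.exp.mul contDiff_snd.cos
  · simp only [logPolar]
    exact contDiff_fst.exp.mul contDiff_snd.sin

lemma norm_sq_logPolar (z : ℝ × ℝ) : ‖logPolar z‖ ^ 2 = exp z.1 ^ 2 := by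
  rw [EuclideanSpace.norm_sq_eq, Fin.sum_univ_two]
  simp only [logPolar, Real.norm_eq_abs, sq_abs]
  simp
  nlinarith [sin_sq_add_cos_sq z.2]

lemma norm_logPolar (z : ℝ × ℝ) : ‖logPolar z‖ = exp z.1 := by
  have := norm_sq_logPolar z
  rwa [sq_eq_sq₀ (norm_nonneg _) (exp_pos _).le] at this

lemma injOn_logPolar {β : ℝ} (hβ : β ≤ 2 * π) : InjOn logPolar (univ ×ˢ Ioo 0 β) := by
  rintro ⟨t, θ⟩ ⟨-, hθ⟩ ⟨s, φ⟩ ⟨-, hφ⟩ h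
  have hts : t = s := by
    have := congrArg norm h
    rw [norm_logPolar, norm_logPolar] at this
    exact exp_injective this
  subst hts
  have h0 : exp t * cos θ = exp t * cos φ := congrArg (fun p => p 0) h
  have h1 : exp t * sin θ = exp t * sin φ := congrArg (fun p => p 1) h
  have h0' := mul_left_cancel₀ (exp_pos t).ne' h0
  have h1' := mul_left_cancel₀ (exp_pos t).ne' h1
  have hc : cos (θ - φ) = 1 := by
    rw [cos_sub, h0', h1']; nlinarith [sin_sq_add_cos_sq φ]
  simp only [mem_Ioo] at hθ hφ
  rw [cos_eq_one_iff_of_lt_of_lt (by linarith [hθ.1, hφ.2]) (by linarith [hθ.2, hφ.1])] at hc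
  exact Prod.ext rfl (by simpa using sub_eq_zero.mp hc)

lemma image_logPolar (β : ℝ) : logPolar '' (univ ×ˢ Ioo 0 β) = sector β := by
  ext p
  constructor
  · rintro ⟨⟨t, θ⟩, ⟨-, hθ⟩, rfl⟩
    exact ⟨exp t, θ, exp_pos t, hθ.1, hθ.2, rfl, rfl⟩
  · rintro ⟨r, θ, hr, h0, h1, hp0, hp1⟩
    refine ⟨(log r, θ), ⟨mem_univ _, h0, h1⟩, ?_⟩
    ext i
    fin_cases i
    · simp [logPolar, exp_log hr, hp0]
    · simp [logPolar, exp_log hr, hp1]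

/-- The derivative of the logarithmic polar coordinates. -/
noncomputable def fderivLogPolar (z : ℝ × ℝ) : ℝ × ℝ →L[ℝ] ℝ × ℝ :=
  (Matrix.toLin (.finTwoProd ℝ) (.finTwoProd ℝ)
    !![exp z.1 * cos z.2, -(exp z.1 * sin z.2);
      exp z.1 * sin z.2, exp z.1 * cos z.2]).toContinuousLinearMap

lemma hasFDerivAt_logPolar_prod (z : ℝ × ℝ) :
    HasFDerivAt (fun z : ℝ × ℝ => (exp z.1 * cos z.2, exp z.1 * sin z.2))
      (fderivLogPolar z) z := by
  unfold fderivLogPolar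
  rw [Matrix.toLin_finTwoProd_toContinuousLinearMap]
  have e := (hasDerivAt_exp z.1).comp_hasFDerivAt z (hasFDerivAt_fst (𝕜 := ℝ))
  convert!
    HasFDerivAt.prodMk (𝕜 := ℝ)
      (e.mul ((hasDerivAt_cos z.2).comp_hasFDerivAt z hasFDerivAt_snd))
      (e.mul ((hasDerivAt_sin z.2).comp_hasFDerivAt z hasFDerivAt_snd)) using
    2 <;>
  simp [smul_smul, add_comm, neg_smul _ (ContinuousLinearMap.snd ℝ ℝ ℝ), mul_comm]

lemma det_fderivLogPolar (z : ℝ × ℝ) : (fderivLogPolar z).det = exp z.1 ^ 2 := by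
  unfold fderivLogPolar
  simp only [LinearMap.det_toContinuousLinearMap, LinearMap.det_toLin,
    Matrix.det_fin_two_of]
  nlinarith [sin_sq_add_cos_sq z.2]

lemma setIntegral_sector {β : ℝ} (hβ : β ≤ 2 * π) (f : EuclideanSpace ℝ (Fin 2) → ℝ) :
    ∫ x in sector β, f x = ∫ z in univ ×ˢ Ioo 0 β, exp z.1 ^ 2 * f (logPolar z) := by
  let e : ℝ × ℝ ≃ᵐ EuclideanSpace ℝ (Fin 2) :=
    (MeasurableEquiv.finTwoArrow (α := ℝ)).symm.trans (MeasurableEquiv.toLp 2 (Fin 2 → ℝ))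
  have he : MeasurePreserving e volume volume :=
    ((volume_preserving_finTwoArrow ℝ).symm _).trans
      (EuclideanSpace.volume_preserving_symm_measurableEquiv_toLp (Fin 2)).symm
  let g : ℝ × ℝ → ℝ × ℝ := fun z => (exp z.1 * cos z.2, exp z.1 * sin z.2)
  have heg : ∀ z, e (g z) = logPolar z := by
    intro z
    ext i
    fin_cases i <;> rfl
  have hpre : e ⁻¹' sector β = g '' (univ ×ˢ Ioo 0 β) := by
    rw [← image_logPolar, ← show e ∘ g = logPolar from funext heg, image_comp,
      preimage_image_eq _ e.injective]
  rw [← he.setIntegral_preimage_emb e.measurableEmbedding, hpre,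
    integral_image_eq_integral_abs_det_fderiv_smul volume
      (MeasurableSet.univ.prod measurableSet_Ioo)
      (fun z _ => (hasFDerivAt_logPolar_prod z).hasFDerivWithinAt)]
  · simp only [det_fderivLogPolar, abs_of_nonneg (sq_nonneg (exp _)), smul_eq_mul]
    simp only [g] at heg
    simp only [heg]
  · intro x hx y hy hxy
    refine injOn_logPolar hβ hx hy ?_
    rw [← heg, ← heg]; exact congrArg e hxy

lemma gradient_logPolar {u : EuclideanSpace ℝ (Fin 2) → ℝ} {z : ℝ × ℝ}
    (hu : DifferentiableAt ℝ u (logPolar z)) :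
    exp z.1 ^ 2 * ‖gradient u (logPolar z)‖ ^ 2 =
      deriv (fun t => u (logPolar (t, z.2))) z.1 ^ 2 +
      deriv (fun θ => u (logPolar (z.1, θ))) z.2 ^ 2 := by
  obtain ⟨t, θ⟩ := z
  set v := gradient u (logPolar (t, θ)) with hv
  have key : ∀ (γ : ℝ → EuclideanSpace ℝ (Fin 2)) (a b s : ℝ),
      HasDerivAt γ !₂[a, b] s → γ s = logPolar (t, θ) →
      deriv (fun s => u (γ s)) s = v 0 * a + v 1 * b := by
    intro γ a b s hγ hs
    have h1 : HasFDerivAt u (fderiv ℝ u (γ s)) (γ s) := by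
      rw [hs]; exact hu.hasFDerivAt
    have h2 := (h1.comp_hasDerivAt s hγ).deriv
    rw [show (fun s => u (γ s)) = u ∘ γ from rfl, h2, hs, ← inner_gradient_left, ← hv]
    simp [PiLp.inner_apply, Fin.sum_univ_two, mul_comm]
  have d1 : HasDerivAt (fun t => logPolar (t, θ)) !₂[exp t * cos θ, exp t * sin θ] t := by
    rw [hasDerivAt_iff_hasFDerivAt, ← hasFDerivWithinAt_univ, hasFDerivWithinAt_euclidean]
    intro i
    rw [hasFDerivWithinAt_univ]
    refine HasDerivAt.hasFDerivAt
      (f' := (!₂[exp t * cos θ, exp t * sin θ] : EuclideanSpace ℝ (Fin 2)) i) ?_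
      |>.congr_fderiv (by ext; simp)
    fin_cases i
    · simpa [logPolar] using (hasDerivAt_exp t).mul_const (cos θ)
    · simpa [logPolar] using (hasDerivAt_exp t).mul_const (sin θ)
  have d2 : HasDerivAt (fun θ => logPolar (t, θ)) !₂[-(exp t * sin θ), exp t * cos θ] θ := by
    rw [hasDerivAt_iff_hasFDerivAt, ← hasFDerivWithinAt_univ, hasFDerivWithinAt_euclidean]
    intro i
    rw [hasFDerivWithinAt_univ]
    refine HasDerivAt.hasFDerivAt
      (f' := (!₂[-(exp t * sin θ), exp t * cos θ] : EuclideanSpace ℝ (Fin 2)) i) ?_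
      |>.congr_fderiv (by ext; simp)
    fin_cases i
    · simpa [logPolar] using (hasDerivAt_cos θ).const_mul (exp t)
    · simpa [logPolar] using (hasDerivAt_sin θ).const_mul (exp t)
  rw [key _ _ _ _ d1 rfl, key _ _ _ _ d2 rfl, EuclideanSpace.norm_sq_eq, Fin.sum_univ_two]
  simp only [Real.norm_eq_abs, sq_abs]
  linear_combination -(exp t ^ 2 * (v 0 ^ 2 + v 1 ^ 2)) * sin_sq_add_cos_sq θ

lemma dist_sq_logPolar (t θ k α : ℝ) :
    dist (logPolar (t, θ)) !₂[k * cos α, k * sin α] ^ 2 =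
      exp t ^ 2 + k ^ 2 - 2 * (exp t * k * cos (θ - α)) := by
  rw [EuclideanSpace.dist_sq_eq, Fin.sum_univ_two]
  simp only [logPolar, Real.dist_eq, sq_abs]
  simp only [Matrix.cons_val_zero, Matrix.cons_val_one]
  rw [cos_sub]
  linear_combination exp t ^ 2 * sin_sq_add_cos_sq θ + k ^ 2 * sin_sq_add_cos_sq α

lemma notMem_sector_of_boundary {β α k : ℝ} (hk : 0 ≤ k) (hα : ∀ φ, 0 < φ → φ < β →
    φ - α ≠ 0 ∧ |φ - α| < 2 * π) : !₂[k * cos α, k * sin α] ∉ sector β := by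
  rintro ⟨r, φ, hr, h0, h1, hp0, hp1⟩
  obtain ⟨hne, hlt⟩ := hα φ h0 h1
  simp only [Matrix.cons_val_zero, Matrix.cons_val_one] at hp0 hp1
  have hsq : k ^ 2 = r ^ 2 := by
    linear_combination (k * cos α + r * cos φ) * hp0 + (k * sin α + r * sin φ) * hp1
      - k ^ 2 * sin_sq_add_cos_sq α + r ^ 2 * sin_sq_add_cos_sq φ
  rw [sq_eq_sq₀ hk hr.le] at hsq
  subst hsq
  have e0 := mul_left_cancel₀ hr.ne' hp0
  have e1 := mul_left_cancel₀ hr.ne' hp1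
  have hc : cos (φ - α) = 1 := by
    rw [cos_sub, e0, e1]; nlinarith [sin_sq_add_cos_sq φ]
  rw [abs_lt] at hlt
  rw [cos_eq_one_iff_of_lt_of_lt (by linarith) (by linarith)] at hc
  exact hne hc

lemma exists_logPolar_eq {p : EuclideanSpace ℝ (Fin 2)} (hp : p ≠ 0) :
    ∃ t φ, 0 < φ ∧ φ ≤ 2 * π ∧ p = logPolar (t, φ) := by
  set w : ℂ := ⟨-p 0, -p 1⟩ with hw
  have hw0 : w ≠ 0 := by
    intro h
    apply hp
    have h0 := congrArg Complex.re h
    have h1 := congrArg Complex.im h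
    ext i
    fin_cases i
    · simpa [hw] using h0
    · simpa [hw] using h1
  have hn : 0 < ‖w‖ := norm_pos_iff.mpr hw0
  refine ⟨log ‖w‖, π + w.arg, by linarith [w.neg_pi_lt_arg], by linarith [w.arg_le_pi], ?_⟩
  have h0 : ‖w‖ * cos w.arg = w.re := Complex.norm_mul_cos_arg w
  have h1 : ‖w‖ * sin w.arg = w.im := Complex.norm_mul_sin_arg w
  ext i
  fin_cases i
  · change p 0 = exp (log ‖w‖) * cos (π + w.arg)
    rw [exp_log hn, add_comm, cos_add_pi, mul_neg, h0, neg_neg]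
  · change p 1 = exp (log ‖w‖) * sin (π + w.arg)
    rw [exp_log hn, add_comm, sin_add_pi, mul_neg, h1, neg_neg]

lemma infDist_logPolar {β : ℝ} (hβ : π ≤ β) (hβ' : β ≤ 2 * π) {t θ : ℝ} (h0 : 0 < θ)
    (h1 : θ < β) :
    Metric.infDist (logPolar (t, θ)) (sector β)ᶜ = exp t * angDist β θ := by
  have hπ := pi_pos
  have he := exp_pos t
  have hfoot0 : ∀ k, 0 ≤ k → !₂[k * cos 0, k * sin 0] ∈ (sector β)ᶜ := fun k hk =>
    notMem_sector_of_boundary hk fun φ p q =>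
      ⟨by linarith, by rw [abs_lt]; constructor <;> linarith⟩
  have hfoot1 : ∀ k, 0 ≤ k → !₂[k * cos β, k * sin β] ∈ (sector β)ᶜ := fun k hk =>
    notMem_sector_of_boundary hk fun φ p q =>
      ⟨by linarith, by rw [abs_lt]; constructor <;> linarith⟩
  have hpos := angDist_pos h0 h1
  apply le_antisymm
  · have aux : ∀ q ∈ (sector β)ᶜ, dist (logPolar (t, θ)) q ^ 2 = (exp t * angDist β θ) ^ 2 →
        Metric.infDist (logPolar (t, θ)) (sector β)ᶜ ≤ exp t * angDist β θ := by
      intro q hq h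
      rw [sq_eq_sq₀ dist_nonneg (by positivity)] at h
      exact h ▸ Metric.infDist_le_dist_of_mem hq
    unfold angDist at *
    rcases min_choice (min θ (β - θ)) (π / 2) with hm | hm
    · have hle := min_eq_left_iff.mp hm
      rcases min_choice θ (β - θ) with hm' | hm'
      · rw [hm'] at hle hm
        rw [hm', hm] at aux ⊢
        refine aux _ (hfoot0 (exp t * cos θ) (mul_nonneg he.le
          (cos_nonneg_of_neg_pi_div_two_le_of_le (by linarith) hle))) ?_
        rw [dist_sq_logPolar, sub_zero]
        linear_combination -exp t ^ 2 * sin_sq_add_cos_sq θ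
      · rw [hm'] at hle hm
        rw [hm', hm] at aux ⊢
        refine aux _ (hfoot1 (exp t * cos (β - θ)) (mul_nonneg he.le
          (cos_nonneg_of_neg_pi_div_two_le_of_le (by linarith) hle))) ?_
        rw [dist_sq_logPolar, ← cos_neg (θ - β), neg_sub]
        linear_combination -exp t ^ 2 * sin_sq_add_cos_sq (β - θ)
    · rw [hm] at aux ⊢
      refine aux _ (hfoot0 0 le_rfl) ?_
      rw [dist_sq_logPolar, sin_pi_div_two]
      ring
  · refine (Metric.le_infDist ⟨_, hfoot0 0 le_rfl⟩).mpr fun q hq => ?_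
    have hle1 := angDist_le_one β θ
    rw [← sq_le_sq₀ (by positivity) dist_nonneg]
    by_cases hq0 : q = 0
    · rw [hq0, dist_zero_right, norm_logPolar]
      have : exp t * angDist β θ ≤ exp t := mul_le_of_le_one_right he.le hle1
      gcongr
    obtain ⟨s, φ, p0, p1, rfl⟩ := exists_logPolar_eq hq0
    have hφ : β ≤ φ := by
      by_contra! hlt
      exact hq ⟨exp s, φ, exp_pos s, p0, hlt, rfl, rfl⟩
    have hd := dist_sq_logPolar t θ (exp s) φ
    change dist (logPolar (t, θ)) (logPolar (s, φ)) ^ 2 = _ at hd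
    rw [hd, ← cos_neg (θ - φ), neg_sub]
    have hs := exp_pos s
    rcases le_or_gt (cos (φ - θ)) 0 with hc | hc
    · have : exp t * exp s * cos (φ - θ) ≤ 0 :=
        mul_nonpos_of_nonneg_of_nonpos (by positivity) hc
      have h2 : angDist β θ ^ 2 ≤ 1 := by nlinarith
      nlinarith [mul_le_mul_of_nonneg_left h2 (sq_nonneg (exp t)), sq_nonneg (exp s)]
    have hsin : angDist β θ ^ 2 ≤ sin (φ - θ) ^ 2 := by
      rcases le_or_gt (φ - θ) (π / 2) with hlt | hgt
      · have : angDist β θ ≤ sin (φ - θ) :=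
          sin_le_sin_of_le_of_le_pi_div_two
            (by have : 0 < min (min θ (β - θ)) (π / 2) := by
                  simp only [lt_min_iff]; exact ⟨⟨h0, by linarith⟩, by linarith⟩
                linarith) hlt
            ((min_le_left _ _).trans ((min_le_right _ _).trans (by linarith)))
        gcongr
      · have h3 : 3 * π / 2 < φ - θ := by
          by_contra! hle
          exact absurd (cos_nonpos_of_pi_div_two_le_of_le hgt.le (by linarith)) (by linarith)
        have : angDist β θ ≤ sin (2 * π - (φ - θ)) :=
          sin_le_sin_of_le_of_le_pi_div_two
            (by have : 0 < min (min θ (β - θ)) (π / 2) := by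
                  simp only [lt_min_iff]; exact ⟨⟨h0, by linarith⟩, by linarith⟩
                linarith) (by linarith)
            ((min_le_left _ _).trans ((min_le_left _ _).trans (by linarith)))
        rw [sin_two_pi_sub] at this
        nlinarith
    nlinarith [mul_le_mul_of_nonneg_left hsin (sq_nonneg (exp t)),
      sin_sq_add_cos_sq (φ - θ), sq_nonneg (exp s - exp t * cos (φ - θ))]

lemma logPolar_zero_notMem_sector {β : ℝ} (hβ' : β ≤ 2 * π) (t : ℝ) :
    logPolar (t, 0) ∉ sector β := by
  exact notMem_sector_of_boundary (exp_pos t).le fun φ p q =>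
    ⟨by linarith, by rw [abs_lt]; constructor <;> linarith⟩

lemma logPolar_angle_notMem_sector {β : ℝ} (hβ' : β ≤ 2 * π) (t : ℝ) :
    logPolar (t, β) ∉ sector β := by
  exact notMem_sector_of_boundary (exp_pos t).le fun φ p q =>
    ⟨by linarith, by rw [abs_lt]; constructor <;> linarith⟩

lemma zero_notMem_sector {β : ℝ} : (0 : EuclideanSpace ℝ (Fin 2)) ∉ sector β := by
  rw [← image_logPolar]
  rintro ⟨z, -, hz⟩
  have := norm_logPolar z
  rw [hz, norm_zero] at this
  exact (exp_pos _).ne this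

lemma exists_bound_of_logPolar_mem {K : Set (EuclideanSpace ℝ (Fin 2))} (hK : IsCompact K)
    (h0 : (0 : EuclideanSpace ℝ (Fin 2)) ∉ K) : ∃ T, ∀ z, logPolar z ∈ K → |z.1| ≤ T := by
  obtain ⟨T, hT⟩ := hK.exists_bound_of_continuousOn (f := fun p => log ‖p‖)
    (continuous_norm.continuousOn.log fun p hp => norm_ne_zero_iff.mpr fun h => h0 (h ▸ hp))
  refine ⟨T, fun z hz => ?_⟩
  simpa [norm_logPolar] using hT _ hz

lemma hardy_lhs_sector {β : ℝ} (hβ : π ≤ β) (hβ' : β ≤ 2 * π)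
    (u : EuclideanSpace ℝ (Fin 2) → ℝ) :
    ∫ x in sector β, u x ^ 2 / Metric.infDist x (sector β)ᶜ ^ 2 =
      ∫ z in univ ×ˢ Ioo 0 β, u (logPolar z) ^ 2 / angDist β z.2 ^ 2 := by
  rw [setIntegral_sector hβ']
  refine setIntegral_congr_fun (MeasurableSet.univ.prod measurableSet_Ioo) ?_
  rintro ⟨t, θ⟩ ⟨-, h⟩
  simp only [infDist_logPolar hβ hβ' h.1 h.2]
  have := exp_pos t
  have := angDist_pos h.1 h.2
  field_simp

lemma integrableOn_strip {β T : ℝ} {F : ℝ × ℝ → ℝ} (hF : Continuous F)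
    (hT : ∀ z, F z ≠ 0 → |z.1| ≤ T) : IntegrableOn F (univ ×ˢ Ioo 0 β) := by
  have hc : IntegrableOn F (Icc (-T) T ×ˢ Icc 0 β) :=
    hF.continuousOn.integrableOn_compact (isCompact_Icc.prod isCompact_Icc)
  refine hc.of_forall_sdiff_eq_zero (MeasurableSet.univ.prod measurableSet_Ioo) ?_
  rintro ⟨t, θ⟩ ⟨⟨-, h⟩, h'⟩
  by_contra hne
  exact h' ⟨abs_le.mp (hT _ hne), Ioo_subset_Icc_self h⟩

lemma continuous_gradient {u : EuclideanSpace ℝ (Fin 2) → ℝ} (hu : ContDiff ℝ ∞ u) :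
    Continuous (gradient u) :=
  (InnerProductSpace.toDual ℝ _).symm.continuous.comp (hu.continuous_fderiv (by simp))

lemma AngularHardy.sector_inequality {β c : ℝ} (hβ : π ≤ β) (hβ' : β ≤ 2 * π)
    (h : AngularHardy β c) {u : EuclideanSpace ℝ (Fin 2) → ℝ}
    (hu : ContDiff ℝ ∞ u) (hs : HasCompactSupport u) (hsub : tsupport u ⊆ sector β) :
    c * ∫ x in sector β, u x ^ 2 / Metric.infDist x (sector β)ᶜ ^ 2 ≤
      ∫ x in sector β, ‖gradient u x‖ ^ 2 := by
  have hβ0 : 0 ≤ β := pi_pos.le.trans hβ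
  rw [hardy_lhs_sector hβ hβ', setIntegral_sector hβ']
  set F : ℝ × ℝ → ℝ := fun z => exp z.1 ^ 2 * ‖gradient u (logPolar z)‖ ^ 2 with hF
  have hFc : Continuous F :=
    ((continuous_exp.comp continuous_fst).pow 2).mul
      (((continuous_gradient hu).comp contDiff_logPolar.continuous).norm.pow 2)
  have hF0 : ∀ z, 0 ≤ F z := fun z => by positivity
  obtain ⟨T, hT⟩ := exists_bound_of_logPolar_mem hs fun h0 => zero_notMem_sector (hsub h0)
  have hFi : IntegrableOn F (univ ×ˢ Ioo 0 β) := by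
    refine integrableOn_strip (T := T) hFc fun z hz => hT z ?_
    refine support_fderiv_subset ℝ fun h0 => hz ?_
    simp [hF, gradient, h0]
  by_cases hG : IntegrableOn (fun z : ℝ × ℝ => u (logPolar z) ^ 2 / angDist β z.2 ^ 2)
      (univ ×ˢ Ioo 0 β)
  swap
  · rw [integral_undef hG, mul_zero]
    exact integral_nonneg hF0
  rw [Measure.volume_eq_prod] at hFi hG ⊢
  rw [setIntegral_prod _ hG, setIntegral_prod _ hFi, ← integral_const_mul]
  rw [IntegrableOn, ← Measure.prod_restrict] at hFi hG
  refine integral_mono (hG.integral_prod_left.const_mul c) hFi.integral_prod_left fun t => ?_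
  have hψ : ContDiff ℝ ∞ fun θ => u (logPolar (t, θ)) :=
    hu.comp (contDiff_logPolar.comp (contDiff_const.prodMk contDiff_id))
  have hvan : ∀ θ, logPolar (t, θ) ∉ sector β → ∀ᶠ φ in 𝓝 θ, u (logPolar (t, φ)) = 0 := by
    intro θ hθ
    have hcont : Continuous fun φ => logPolar (t, φ) :=
      contDiff_logPolar.continuous.comp (by fun_prop)
    exact hcont.continuousAt.eventually
      (notMem_tsupport_iff_eventuallyEq.mp fun hm => hθ (hsub hm))
  have key := h _ hψ (hvan 0 (logPolar_zero_notMem_sector hβ' t))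
    (hvan β (logPolar_angle_notMem_sector hβ' t))
  simp only [← integral_Ioc_eq_integral_Ioo, ← intervalIntegral.integral_of_le hβ0]
  refine key.trans (intervalIntegral.integral_mono hβ0 ?_ ?_ fun θ => ?_)
  · exact ((hψ.continuous_deriv (by simp)).pow 2).intervalIntegrable _ _
  · exact (hFc.comp (by fun_prop : Continuous fun θ : ℝ => (t, θ))).intervalIntegrable _ _
  · have := gradient_logPolar (z := (t, θ)) (hu.differentiable (by simp) _)
    simp only [hF]
    rw [this]
    exact le_add_of_nonneg_left (sq_nonneg _)

lemma isOpen_sector {β : ℝ} (hβ : π ≤ β) (hβ' : β ≤ 2 * π) : IsOpen (sector β) := by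
  rw [← isClosed_compl_iff]
  refine isClosed_of_closure_subset fun p hp hmem => ?_
  rw [Metric.mem_closure_iff_infDist_zero ⟨_, zero_notMem_sector⟩] at hp
  rw [← image_logPolar] at hmem
  obtain ⟨⟨t, θ⟩, ⟨-, h⟩, rfl⟩ := hmem
  rw [infDist_logPolar hβ hβ' h.1 h.2] at hp
  have := angDist_pos h.1 h.2
  have := exp_pos t
  exact absurd hp (by positivity)

/-- The logarithm of `-p`, where the plane is identified with `ℂ`. -/
noncomputable def planeLog (p : EuclideanSpace ℝ (Fin 2)) : ℂ :=
  Complex.log (-((p 0 : ℂ) + (p 1 : ℂ) * Complex.I))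

lemma neg_logPolar_eq_exp (t θ : ℝ) :
    -(((logPolar (t, θ) 0 : ℝ) : ℂ) + ((logPolar (t, θ) 1 : ℝ) : ℂ) * Complex.I) =
      Complex.exp ((t : ℂ) + ((θ - π : ℝ) : ℂ) * Complex.I) := by
  rw [Complex.exp_add, Complex.exp_mul_I, ← Complex.ofReal_cos, ← Complex.ofReal_sin,
    cos_sub_pi, sin_sub_pi]
  simp [logPolar]
  ring

lemma planeLog_logPolar {t θ : ℝ} (h0 : 0 < θ) (h1 : θ < 2 * π) :
    planeLog (logPolar (t, θ)) = (t : ℂ) + ((θ - π : ℝ) : ℂ) * Complex.I := by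
  rw [planeLog, neg_logPolar_eq_exp, Complex.log_exp]
  · simp; linarith
  · simp; linarith

lemma contDiffAt_planeLog {t θ : ℝ} (h0 : 0 < θ) (h1 : θ < 2 * π) :
    ContDiffAt ℝ ∞ planeLog (logPolar (t, θ)) := by
  have hslit : -(((logPolar (t, θ) 0 : ℝ) : ℂ) + ((logPolar (t, θ) 1 : ℝ) : ℂ) * Complex.I) ∈
      Complex.slitPlane := by
    rw [Complex.mem_slitPlane_iff_arg]
    constructor
    · rw [← Complex.log_im]
      change (planeLog _).im ≠ π
      rw [planeLog_logPolar h0 h1]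
      simp
      linarith
    · rw [neg_logPolar_eq_exp]
      exact Complex.exp_ne_zero _
  refine ContDiffAt.comp (g := Complex.log) (logPolar (t, θ))
    ((Complex.contDiffAt_log hslit).restrict_scalars ℝ) ?_
  have hcoord : ∀ i : Fin 2, ContDiff ℝ ∞ fun p : EuclideanSpace ℝ (Fin 2) => ((p i : ℝ) : ℂ) :=
    fun i => Complex.ofRealCLM.contDiff.comp (contDiff_euclidean.mp contDiff_id i)
  exact ((hcoord 0).add ((hcoord 1).mul contDiff_const)).neg.contDiffAt

lemma exists_sector_function {β T : ℝ} (hβ : π ≤ β) (hβ' : β ≤ 2 * π) {χ ψ : ℝ → ℝ}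
    (hχ : ContDiff ℝ ∞ χ) (hχ0 : ∀ t, T < |t| → χ t = 0)
    (hψ : ContDiff ℝ ∞ ψ) (h0 : ∀ᶠ θ in 𝓝 0, ψ θ = 0) (h1 : ∀ᶠ θ in 𝓝 β, ψ θ = 0) :
    ∃ u : EuclideanSpace ℝ (Fin 2) → ℝ, ContDiff ℝ ∞ u ∧ HasCompactSupport u ∧
      tsupport u ⊆ sector β ∧
      ∀ t θ, 0 < θ → θ < β → u (logPolar (t, θ)) = χ t * ψ θ := by
  classical
  obtain ⟨ε, hε, hε0⟩ := Metric.eventually_nhds_iff.mp h0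
  obtain ⟨δ, hδ, hδ0⟩ := Metric.eventually_nhds_iff.mp h1
  set K := logPolar '' (Icc (-T) T ×ˢ Icc ε (β - δ)) with hK
  have hKc : IsCompact K :=
    (isCompact_Icc.prod isCompact_Icc).image contDiff_logPolar.continuous
  have hKs : K ⊆ sector β := by
    rw [← image_logPolar]
    refine image_mono fun z hz => ⟨mem_univ _, ?_⟩
    exact ⟨hε.trans_le hz.2.1, hz.2.2.trans_lt (by linarith)⟩
  let f : EuclideanSpace ℝ (Fin 2) → ℝ := fun p => χ (planeLog p).re * ψ (π + (planeLog p).im)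
  have hf : ∀ t θ, 0 < θ → θ < β → f (logPolar (t, θ)) = χ t * ψ θ := by
    intro t θ p q
    simp only [f, planeLog_logPolar p (q.trans_le hβ')]
    simp
  let u : EuclideanSpace ℝ (Fin 2) → ℝ := (sector β).indicator f
  have hu : ∀ t θ, 0 < θ → θ < β → u (logPolar (t, θ)) = χ t * ψ θ := by
    intro t θ p q
    rw [← hf t θ p q]
    refine indicator_of_mem ?_ _
    rw [← image_logPolar]
    exact ⟨_, ⟨mem_univ _, p, q⟩, rfl⟩
  have huK : ∀ p ∉ K, u p = 0 := by
    intro p hp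
    by_cases hps : p ∈ sector β
    · rw [← image_logPolar] at hps
      obtain ⟨⟨t, θ⟩, ⟨-, h⟩, rfl⟩ := hps
      rw [hu t θ h.1 h.2]
      by_contra hne
      refine hp ⟨(t, θ), ⟨?_, ?_, ?_⟩, rfl⟩
      · rw [mem_Icc, ← abs_le]
        by_contra! hlt
        exact hne (by rw [hχ0 t hlt, zero_mul])
      · by_contra! hlt
        refine hne (by rw [hε0, mul_zero]; simpa [abs_of_pos h.1] using hlt)
      · by_contra! hlt
        refine hne (by
          rw [hδ0, mul_zero]
          rw [Real.dist_eq, abs_sub_comm, abs_of_pos (sub_pos.mpr h.2)]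
          simp only at hlt
          linarith)
    · exact indicator_of_notMem hps _
  have hts : tsupport u ⊆ K :=
    closure_minimal (fun p hp => by by_contra hn; exact hp (huK p hn)) hKc.isClosed
  refine ⟨u, contDiff_iff_contDiffAt.mpr fun p => ?_, hKc.of_isClosed_subset (isClosed_tsupport _)
    hts, hts.trans hKs, hu⟩
  by_cases hp : p ∈ K
  · have hps := hKs hp
    have hev : u =ᶠ[𝓝 p] f := by
      filter_upwards [(isOpen_sector hβ hβ').mem_nhds hps] with q hq
      exact indicator_of_mem hq _
    refine ContDiffAt.congr_of_eventuallyEq ?_ hev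
    rw [← image_logPolar] at hps
    obtain ⟨⟨t, θ⟩, ⟨-, h⟩, rfl⟩ := hps
    have hL := contDiffAt_planeLog (t := t) h.1 (h.2.trans_le hβ')
    have hre := Complex.reCLM.contDiff.contDiffAt.comp (logPolar (t, θ)) hL
    have him := Complex.imCLM.contDiff.contDiffAt.comp (logPolar (t, θ)) hL
    exact (hχ.contDiffAt.comp (logPolar (t, θ)) hre).mul
      (hψ.contDiffAt.comp (logPolar (t, θ)) (contDiffAt_const.add him))
  · refine contDiffAt_const (c := (0 : ℝ)) |>.congr_of_eventuallyEq ?_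
    filter_upwards [hKc.isClosed.isOpen_compl.mem_nhds hp] with q hq
    exact huK q hq

lemma integral_hardyBump_div_sq {n : ℝ} (hn : 0 < n) :
    ∫ t, hardyBump (t / n) ^ 2 = n * ∫ t, hardyBump t ^ 2 := by
  rw [Measure.integral_comp_div (fun t => hardyBump t ^ 2), abs_of_pos hn, smul_eq_mul]

lemma AngularHardy.of_sector {β c : ℝ} (hβ : π ≤ β) (hβ' : β ≤ 2 * π)
    (h : ∀ u : EuclideanSpace ℝ (Fin 2) → ℝ,
      ContDiff ℝ (⊤ : ℕ∞) u → HasCompactSupport u → tsupport u ⊆ sector β →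
      c * ∫ x in sector β, u x ^ 2 / Metric.infDist x (sector β)ᶜ ^ 2 ≤
        ∫ x in sector β, ‖gradient u x‖ ^ 2) : AngularHardy β c := by
  intro ψ hψ h0 h1
  have hβ0 : 0 ≤ β := pi_pos.le.trans hβ
  have hmeas : MeasurableSet (univ ×ˢ Ioo 0 β : Set (ℝ × ℝ)) :=
    MeasurableSet.univ.prod measurableSet_Ioo
  have hb : ContDiff ℝ ∞ hardyBump := hardyBump.contDiff
  have hbc : HasCompactSupport hardyBump := hardyBump.hasCompactSupport
  have hb' : Continuous (deriv hardyBump) := hb.continuous_deriv (by simp)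
  set A := ∫ θ in 0..β, ψ θ ^ 2 / angDist β θ ^ 2 with hA
  set B := ∫ θ in 0..β, ψ θ ^ 2 with hB
  set C := ∫ θ in 0..β, deriv ψ θ ^ 2 with hC
  set X := ∫ t, hardyBump t ^ 2 with hX
  set Y := ∫ t, deriv hardyBump t ^ 2 with hY
  have hXpos : 0 < X := by
    refine Continuous.integral_pos_of_hasCompactSupport_nonneg_nonzero (x := 0)
      (hb.continuous.pow 2) ?_ (fun t => sq_nonneg _) ?_
    · exact hbc.comp_left (g := fun y => y ^ 2) (by simp)
    · simp [hardyBump_eq_one]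
  have key : ∀ n : ℝ, 0 < n → c * (n * X * A) ≤ n⁻¹ * Y * B + n * X * C := by
    intro n hn
    have hχ : ContDiff ℝ ∞ fun t => hardyBump (t / n) := hb.comp (contDiff_id.div_const n)
    obtain ⟨u, hu, hus, hut, huv⟩ := exists_sector_function (T := 2 * n) hβ hβ' hχ
      (fun t ht => hardyBump_eq_zero (by
        rw [abs_div, abs_of_pos hn, le_div_iff₀ hn]; exact ht.le)) hψ h0 h1
    have hdχ : ∀ t, deriv (fun t => hardyBump (t / n)) t = n⁻¹ * deriv hardyBump (t / n) := by
      intro t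
      have := ((hb.differentiable (by simp) (t / n)).hasDerivAt.comp t
        ((hasDerivAt_id t).div_const n)).deriv
      rw [mul_comm, inv_eq_one_div]
      exact this
    have hmain := h u hu hus hut
    rw [hardy_lhs_sector hβ hβ', setIntegral_sector hβ'] at hmain
    have e1 : ∫ z in univ ×ˢ Ioo 0 β, u (logPolar z) ^ 2 / angDist β z.2 ^ 2 = n * X * A := by
      rw [setIntegral_congr_fun (g := fun z : ℝ × ℝ =>
        hardyBump (z.1 / n) ^ 2 * (ψ z.2 ^ 2 / angDist β z.2 ^ 2)) hmeas]
      · rw [Measure.volume_eq_prod, setIntegral_prod_mul (fun t => hardyBump (t / n) ^ 2)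
          (fun θ => ψ θ ^ 2 / angDist β θ ^ 2), Measure.restrict_univ,
          integral_hardyBump_div_sq hn, hA, intervalIntegral.integral_of_le hβ0,
          integral_Ioc_eq_integral_Ioo]
      · rintro ⟨t, θ⟩ ⟨-, hθ⟩
        simp only [huv t θ hθ.1 hθ.2]
        ring
    have e2 : ∫ z in univ ×ˢ Ioo 0 β, exp z.1 ^ 2 * ‖gradient u (logPolar z)‖ ^ 2 =
        n⁻¹ * Y * B + n * X * C := by
      rw [setIntegral_congr_fun (g := fun z : ℝ × ℝ =>
        (n⁻¹ * deriv hardyBump (z.1 / n)) ^ 2 * ψ z.2 ^ 2 +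
          hardyBump (z.1 / n) ^ 2 * deriv ψ z.2 ^ 2) hmeas]
      · have hvan : ∀ t : ℝ, 2 * n < |t| → hardyBump (t / n) = 0 := fun t ht =>
          hardyBump_eq_zero (by rw [abs_div, abs_of_pos hn, le_div_iff₀ hn]; exact ht.le)
        rw [integral_add]
        · rw [Measure.volume_eq_prod,
            setIntegral_prod_mul (fun t => (n⁻¹ * deriv hardyBump (t / n)) ^ 2) (fun θ => ψ θ ^ 2),
            setIntegral_prod_mul (fun t => hardyBump (t / n) ^ 2) (fun θ => deriv ψ θ ^ 2),
            Measure.restrict_univ, integral_hardyBump_div_sq hn, hB, hC,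
            intervalIntegral.integral_of_le hβ0, intervalIntegral.integral_of_le hβ0,
            integral_Ioc_eq_integral_Ioo, integral_Ioc_eq_integral_Ioo]
          simp only [mul_pow]
          rw [integral_const_mul, Measure.integral_comp_div (fun t => deriv hardyBump t ^ 2),
            abs_of_pos hn, smul_eq_mul]
          rw [← hY]
          congr 2
          field_simp
        · refine integrableOn_strip (T := 2 * n) ?_ ?_
          · exact ((continuous_const.mul (hb'.comp (continuous_fst.div_const n))).pow 2).mul
              ((hψ.continuous.comp continuous_snd).pow 2)
          · rintro ⟨t, θ⟩ hne
            by_contra! hlt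
            refine hne ?_
            have : deriv (fun t => hardyBump (t / n)) t = 0 := by
              have hev : (fun t => hardyBump (t / n)) =ᶠ[𝓝 t] fun _ => 0 := by
                filter_upwards [(isOpen_lt continuous_const continuous_abs).mem_nhds hlt] with s hs
                exact hvan s hs
              rw [hev.deriv_eq, deriv_const]
            simp only [← hdχ, this]
            ring
        · refine integrableOn_strip (T := 2 * n) ?_ ?_
          · exact ((hb.continuous.comp (continuous_fst.div_const n)).pow 2).mul
              (((hψ.continuous_deriv (by simp)).comp continuous_snd).pow 2)
          · rintro ⟨t, θ⟩ hne
            by_contra! hlt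
            refine hne ?_
            simp only [hvan t hlt]
            ring
      · rintro ⟨t, θ⟩ ⟨-, hθ⟩
        simp only
        rw [gradient_logPolar (z := (t, θ)) (hu.differentiable (by simp) _)]
        have d1 : (fun s => u (logPolar (s, θ))) = fun s => hardyBump (s / n) * ψ θ :=
          funext fun s => huv s θ hθ.1 hθ.2
        have d2 : (fun φ => u (logPolar (t, φ))) =ᶠ[𝓝 θ] fun φ => hardyBump (t / n) * ψ φ := by
          filter_upwards [isOpen_Ioo.mem_nhds hθ] with φ hφ
          exact huv t φ hφ.1 hφ.2
        simp only
        rw [d1, d2.deriv_eq, deriv_mul_const (hχ.differentiable (by simp) t), hdχ,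
          deriv_const_mul _ (hψ.differentiable (by simp) θ)]
        ring
    rwa [e1, e2] at hmain
  have hlim : Tendsto (fun n : ℝ => n⁻¹ ^ 2 * (Y * B / X) + C) atTop (𝓝 C) := by
    simpa using ((tendsto_inv_atTop_zero (𝕜 := ℝ)).pow 2).mul_const (Y * B / X) |>.add_const C
  refine ge_of_tendsto hlim ?_
  filter_upwards [eventually_gt_atTop 0] with n hn
  have := key n hn
  have h2 : 0 < n * X := mul_pos hn hXpos
  rw [← mul_le_mul_iff_right₀ h2]
  calc n * X * (c * A) = c * (n * X * A) := by ring
    _ ≤ _ := this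
    _ = _ := by field_simp

lemma hardyConst_sector {β : ℝ} (hβ : π ≤ β) (hβ' : β ≤ 2 * π) :
    hardyConst (sector β) = sSup {c | 0 ≤ c ∧ AngularHardy β c} := by
  unfold hardyConst
  congr 1
  ext c
  exact ⟨fun h => ⟨h.1, .of_sector hβ hβ' h.2⟩, fun h => ⟨h.1, fun u hu hs hsub =>
    h.2.sector_inequality hβ hβ' hu hs hsub⟩⟩

lemma angularHardy_of_tendsto {β c : ℝ} {ι : Type*} {l : Filter ι} [l.NeBot] {f : ι → ℝ}
    (hf : Tendsto f l (𝓝 c)) (h : ∀ᶠ i in l, AngularHardy β (f i)) : AngularHardy β c :=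
  fun ψ hψ h0 h1 => le_of_tendsto (hf.mul_const _) (h.mono fun _ hi => hi ψ hψ h0 h1)

lemma angularHardy_csSup {β : ℝ} (hβ : π ≤ β) :
    0 < sSup {c | 0 ≤ c ∧ AngularHardy β c} ∧
      AngularHardy β (sSup {c | 0 ≤ c ∧ AngularHardy β c}) := by
  have hπ := pi_pos
  have hq : AngularHardy π (1 / 4) := angularHardy_quarter le_rfl (by linarith)
  have hst := hq.stretch hπ.le (by norm_num) ((one_le_div hπ).mpr hβ)
  rw [div_mul_cancel₀ _ hπ.ne'] at hst
  have hβ0 : 0 < β := hπ.trans_le hβ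
  have hpos : 0 < 1 / 4 / (β / π) ^ 2 := by positivity
  have hbdd : BddAbove {c | 0 ≤ c ∧ AngularHardy β c} :=
    ⟨1 / 4, fun c hc => AngularHardy.le_quarter hβ hc.1 hc.2⟩
  refine ⟨hpos.trans_le (le_csSup hbdd ⟨hpos.le, hst⟩), ?_⟩
  obtain ⟨v, -, hv, hmem⟩ := exists_seq_tendsto_sSup
    (S := {c | 0 ≤ c ∧ AngularHardy β c}) ⟨_, hpos.le, hst⟩ hbdd
  exact angularHardy_of_tendsto hv (Eventually.of_forall fun n => (hmem n).2)

lemma AngularHardy.anti_angle {β β' c : ℝ} (hβ : π ≤ β) (hβ' : β ≤ β') (hc : 0 ≤ c)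
    (h : AngularHardy β' c) : AngularHardy β c := by
  have hβ0 : 0 < β := pi_pos.trans_le hβ
  refine AngularHardy.anti (k := β' / β) hβ ((one_le_div hβ0).mpr hβ') hc ?_
  rwa [div_mul_cancel₀ _ hβ0.ne']

/-- **Davies' theorem on the Hardy constant of sectors.**
There exists a critical angle `β_cr ∈ (π, 2π)` such that `c_β = H(Λ_β) = 1/4` for all
`β ∈ [π, β_cr]`, and `β ↦ c_β` is strictly decreasing on `[β_cr, 2π]`. -/
theorem hardy_constant_sector_critical_angle :
    ∃ βcr : ℝ, Real.pi < βcr ∧ βcr < 2 * Real.pi ∧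
      (∀ β : ℝ, Real.pi ≤ β → β ≤ βcr → hardyConst (sector β) = 1 / 4) ∧
      StrictAntiOn (fun β => hardyConst (sector β)) (Set.Icc βcr (2 * Real.pi)) := by
  have hπ := pi_gt_three
  set S : Set ℝ := {β | π ≤ β ∧ β ≤ 2 * π ∧ AngularHardy β (1 / 4)} with hS
  have hmem : π + 4 / 9 ∈ S :=
    ⟨by linarith, by linarith, angularHardy_quarter (by linarith) le_rfl⟩
  have hbdd : BddAbove S := ⟨2 * π, fun β hβ => hβ.2.1⟩
  have hlow : π + 4 / 9 ≤ sSup S := le_csSup hbdd hmem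
  have hup : sSup S ≤ 2 * π := csSup_le ⟨_, hmem⟩ fun β hβ => hβ.2.1
  have hcr : AngularHardy (sSup S) (1 / 4) := by
    obtain ⟨v, -, hv, hvS⟩ := exists_seq_tendsto_sSup ⟨_, hmem⟩ hbdd
    have hcrpos : 0 < sSup S := by linarith
    have hlim : Tendsto (fun n => 1 / 4 / (sSup S / v n) ^ 2) atTop (𝓝 (1 / 4)) := by
      have : Tendsto (fun n => 1 / 4 / (sSup S / v n) ^ 2) atTop
          (𝓝 (1 / 4 / (sSup S / sSup S) ^ 2)) :=
        tendsto_const_nhds.div ((tendsto_const_nhds.div hv hcrpos.ne').pow 2) (by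
          rw [div_self hcrpos.ne']; norm_num)
      simpa [div_self hcrpos.ne'] using this
    refine angularHardy_of_tendsto hlim (Eventually.of_forall fun n => ?_)
    have hvpos : 0 < v n := by linarith [(hvS n).1]
    have := (hvS n).2.2.stretch hvpos.le (by norm_num)
      ((one_le_div hvpos).mpr (le_csSup hbdd (hvS n)))
    rwa [div_mul_cancel₀ _ hvpos.ne'] at this
  have hlt : sSup S < 2 * π := hup.lt_of_ne fun h => not_angularHardy_two_pi (h ▸ hcr)
  refine ⟨sSup S, by linarith, hlt, fun β h0 h1 => ?_, fun β₁ h₁ β₂ h₂ h12 => ?_⟩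
  · rw [hardyConst_sector h0 (h1.trans hup)]
    have hle : ∀ c ∈ {c | 0 ≤ c ∧ AngularHardy β c}, c ≤ 1 / 4 :=
      fun c hc => AngularHardy.le_quarter h0 hc.1 hc.2
    have hq : (1 / 4 : ℝ) ∈ {c | 0 ≤ c ∧ AngularHardy β c} :=
      ⟨by norm_num, hcr.anti_angle h0 h1 (by norm_num)⟩
    exact le_antisymm (csSup_le ⟨_, hq⟩ hle) (le_csSup ⟨_, hle⟩ hq)
  · have hβ₁ : π ≤ β₁ := by linarith [h₁.1]
    have hβ₂ : π ≤ β₂ := by linarith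
    have hβ₁0 : 0 < β₁ := by linarith
    simp only
    rw [hardyConst_sector hβ₁ h₁.2, hardyConst_sector hβ₂ h₂.2]
    obtain ⟨hpos, hatt⟩ := angularHardy_csSup hβ₂
    set c₂ := sSup {c | 0 ≤ c ∧ AngularHardy β₂ c}
    have hc₂ : c₂ < 1 / 4 := by
      refine (AngularHardy.le_quarter hβ₂ hpos.le hatt).lt_of_ne fun h => ?_
      have : β₂ ≤ sSup S := le_csSup hbdd ⟨hβ₂, h₂.2, h ▸ hatt⟩
      linarith [h₁.1]
    obtain ⟨c', hc', hA⟩ := AngularHardy.improve (k := β₂ / β₁) hβ₁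
      ((one_lt_div hβ₁0).mpr h12) hpos hc₂ (by rwa [div_mul_cancel₀ _ hβ₁0.ne'])
    exact hc'.trans_le (le_csSup ⟨1 / 4, fun c hc => AngularHardy.le_quarter hβ₁ hc.1 hc.2⟩
      ⟨hpos.le.trans hc'.le, hA⟩)
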